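/- arXiv:math/0207192 — 3 statements merged into one kernel-verified Lean document; each statement's English description precedes it below -/
import Mathlib

section
/- Let k ≥ 3 and 1 ≤ m ≤ min{k−1, n}. Then A_1(n, m) = Σ_{j=0}^{m} (−1)^j binom(m−j, j) f_k(n−j), where binom(a,b) denotes the binomial coefficient, equal to 0 when b > a. -/
/-- A permutation `α` of `{1,…,n}` (as `Equiv.Perm (Fin n)`, 0-indexed) contains the
pattern given in one-line notation by the list `w`: there are increasing positions
whose values are order-isomorphic to `w`. -/
def ContainsPattern {n : ℕ} (α : Equiv.Perm (Fin n)) (w : List ℕ) : Prop :=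
  ∃ f : Fin w.length → Fin n, StrictMono f ∧
    ∀ a b : Fin w.length, w.get a < w.get b ↔ α (f a) < α (f b)

/-- `α` avoids the pattern `w`. -/
def AvoidsPattern {n : ℕ} (α : Equiv.Perm (Fin n)) (w : List ℕ) : Prop :=
  ¬ ContainsPattern α w

/-- The pattern of length `2k` (in one-line notation, on values `1,…,2k`) beginning with
`a, k+2, k+3, …, 2k−1`, followed by `1, 2k` (if `sep = true`) or by `2k` (if `sep = false`),
and ending with the remaining elements of `{1,…,2k}` in increasing order. -/
def gonPattern (k a : ℕ) (sep : Bool) : List ℕ :=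
  let pre : List ℕ := a :: (List.range' (k+2) (k-2) ++ (if sep then [1, 2*k] else [2*k]))
  pre ++ ((List.range' 1 (2*k)).filter (fun x => !(pre.contains x)))

/-- `π` is a 321-`k`-gon-avoiding permutation: it avoids `321` and the four
patterns of `𝔓_k`. -/
def Avoids321Gon (k : ℕ) {n : ℕ} (π : Equiv.Perm (Fin n)) : Prop :=
  AvoidsPattern π [3, 2, 1] ∧
    AvoidsPattern π (gonPattern k k true) ∧ AvoidsPattern π (gonPattern k k false) ∧
    AvoidsPattern π (gonPattern k (k+1) true) ∧ AvoidsPattern π (gonPattern k (k+1) false)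

/-- `f_k(n)`: the number of 321-`k`-gon-avoiding permutations of `{1,…,n}`. -/
noncomputable def fgon (k n : ℕ) : ℕ :=
  Nat.card {π : Equiv.Perm (Fin n) // Avoids321Gon k π}

/-- `π` starts (in one-line notation on values `1,…,n`) with the entries listed in `l`,
i.e. `π(1) = l₁, π(2) = l₂, …`. -/
def StartsWith {n : ℕ} (π : Equiv.Perm (Fin n)) (l : List ℕ) : Prop :=
  ∀ (j : Fin l.length) (hj : (j : ℕ) < n), ((π ⟨j, hj⟩ : Fin n) : ℕ) + 1 = l.get j

/-- `f_k(n; i₁,…,i_m)`: the number of 321-`k`-gon-avoiding permutations of `{1,…,n}`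
starting with `i₁ i₂ ⋯ i_m` (given as the list `l`). -/
noncomputable def fstart (k n : ℕ) (l : List ℕ) : ℕ :=
  Nat.card {π : Equiv.Perm (Fin n) // Avoids321Gon k π ∧ StartsWith π l}

/-- `A_d(n,m) = Σ_{d ≤ i₁ < ⋯ < i_m ≤ n} f_k(n; i₁,…,i_m)`. -/
noncomputable def Aseq (k d n m : ℕ) : ℕ :=
  ∑ s ∈ (Finset.Icc d n).powersetCard m, fstart k n (s.sort (· ≤ ·))

/-- `B_d(n,m) = Σ_{d+1 ≤ i₁ < ⋯ < i_m ≤ n} f_k(n; d, i₁,…,i_m)`. -/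
noncomputable def Bseq (k d n m : ℕ) : ℕ :=
  ∑ s ∈ (Finset.Icc (d+1) n).powersetCard m, fstart k n (d :: s.sort (· ≤ ·))

/-- `C_d(n,m) = Σ_{d ≤ i₁ < ⋯ < i_m ≤ n} f_k(n; i₁,…,i_m, 1)`. -/
noncomputable def Cseq (k d n m : ℕ) : ℕ :=
  ∑ s ∈ (Finset.Icc d n).powersetCard m, fstart k n (s.sort (· ≤ ·) ++ [1])

/-- `L_n^k(s) = Σ_{j=0}^{s} (−1)^j C(s−j, j) f_k(n−j)`. -/
noncomputable def Lgon (k n s : ℕ) : ℤ :=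
  ∑ j ∈ Finset.range (s+1), (-1 : ℤ)^j * ((s-j).choose j : ℤ) * (fgon k (n-j) : ℤ)

/-- The first `m` entries of `π` are increasing. -/
def IncreasingPrefix (m : ℕ) {n : ℕ} (π : Equiv.Perm (Fin n)) : Prop :=
  ∀ i j : Fin n, i < j → (j : ℕ) < m → π i < π j

/-- The number of 321-`k`-gon-avoiding permutations whose first `m` entries are increasing. -/
noncomputable def incCount (k n m : ℕ) : ℕ :=
  Nat.card {π : Equiv.Perm (Fin n) // Avoids321Gon k π ∧ IncreasingPrefix m π}

/-- The permutation obtained from `σ` by inserting a new minimal entry at position `p`. -/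
def insertMin {n : ℕ} (p : Fin (n + 1)) (σ : Equiv.Perm (Fin n)) : Equiv.Perm (Fin (n + 1)) :=
  (finSuccEquiv' p).trans ((Equiv.optionCongr σ).trans (finSuccEquiv' 0).symm)

section InsertMin

variable {n : ℕ} (p : Fin (n + 1)) (σ : Equiv.Perm (Fin n))

@[simp] lemma insertMin_self : insertMin p σ p = 0 := by
  simp [insertMin]

@[simp] lemma insertMin_succAbove (i : Fin n) :
    insertMin p σ (p.succAbove i) = (σ i).succ := by
  simp [insertMin]

lemma eq_of_insertMin_apply_eq_zero {x : Fin (n + 1)} (h : insertMin p σ x = 0) : x = p :=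
  (insertMin p σ).injective (h.trans (insertMin_self p σ).symm)

lemma insertMin_injective : Function.Injective (insertMin p) := by
  intro σ τ h
  ext i : 1
  have := congrArg (fun π : Equiv.Perm (Fin (n + 1)) => π (p.succAbove i)) h
  simpa using this

lemma exists_insertMin_eq (π : Equiv.Perm (Fin (n + 1))) (hp : π p = 0) :
    ∃ σ, insertMin p σ = π := by
  let e : Option (Fin n) ≃ Option (Fin n) :=
    (finSuccEquiv' p).symm.trans (π.trans (finSuccEquiv' 0))
  have he : e none = none := by simp [e, hp]
  refine ⟨Equiv.removeNone e, ?_⟩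
  have hopt : Equiv.optionCongr (Equiv.removeNone e) = e := by
    ext1 x
    cases x with
    | none => simp [he]
    | some x =>
      have hx : e (some x) ≠ none := fun h => by
        have := e.injective (h.trans he.symm)
        simp at this
      rw [Equiv.optionCongr_apply, Option.map_some]
      exact Equiv.removeNone_some e (Option.ne_none_iff_exists'.mp hx)
  ext1 x
  simp [insertMin, hopt, e]

variable {p σ}

lemma ContainsPattern.insertMin {w : List ℕ} (h : ContainsPattern σ w) :
    ContainsPattern (insertMin p σ) w := by
  obtain ⟨f, hf, hw⟩ := h
  exact ⟨fun a => p.succAbove (f a), (Fin.strictMono_succAbove p).comp hf,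
    fun a b => by rw [hw]; simp⟩

lemma ContainsPattern.of_insertMin {w : List ℕ} (h : ContainsPattern (_root_.insertMin p σ) w)
    (hmin : ∀ f : Fin w.length → Fin (n + 1), StrictMono f →
      (∀ a b, w.get a < w.get b ↔ _root_.insertMin p σ (f a) < _root_.insertMin p σ (f b)) →
      ∀ c, f c ≠ p) :
    ContainsPattern σ w := by
  obtain ⟨f, hf, hw⟩ := h
  choose g hg using fun c => Fin.exists_succAbove_eq (hmin f hf hw c)
  refine ⟨g, fun a b hab => ?_, fun a b => ?_⟩
  · rw [← (Fin.strictMono_succAbove p).lt_iff_lt, hg, hg]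
    exact hf hab
  · rw [hw, ← hg a, ← hg b]
    simp

end InsertMin

/-- The entries of a gon pattern in its first `k - 1` positions are not minimal. -/
lemma gonPattern_min_position {k a : ℕ} {sep : Bool} (hk : 3 ≤ k) (ha : k ≤ a)
    (c : Fin (gonPattern k a sep).length)
    (hc : ∀ b, (gonPattern k a sep).get c ≤ (gonPattern k a sep).get b) : k - 1 ≤ (c : ℕ) := by
  by_contra! hlt
  have hone : 1 ∈ gonPattern k a sep := by
    simp only [gonPattern]
    rw [List.mem_append]
    by_cases h : 1 ∈ (a :: (List.range' (k+2) (k-2) ++ (if sep then [1, 2*k] else [2*k])))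
    · exact Or.inl h
    · right
      rw [List.mem_filter]
      refine ⟨by simp [List.mem_range'_1]; omega, by simpa using h⟩
  obtain ⟨b, hb⟩ := List.get_of_mem hone
  have hcb := hc b
  rw [hb] at hcb
  have hsplit : gonPattern k a sep = (a :: List.range' (k+2) (k-2)) ++
      ((if sep then [1, 2*k] else [2*k]) ++ ((List.range' 1 (2*k)).filter (fun x =>
        !((a :: (List.range' (k+2) (k-2) ++ (if sep then [1, 2*k] else [2*k]))).contains x)))) := by
    simp [gonPattern]
  have hmem : (gonPattern k a sep).get c ∈ a :: List.range' (k+2) (k-2) := by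
    have hlen : (c : ℕ) < (a :: List.range' (k+2) (k-2)).length := by simp; omega
    have : (gonPattern k a sep).get c = (a :: List.range' (k+2) (k-2))[(c : ℕ)] := by
      rw [List.get_eq_getElem]
      simp only [hsplit]
      rw [List.getElem_append_left hlen]
    rw [this]
    exact List.getElem_mem hlen
  rw [List.mem_cons, List.mem_range'_1] at hmem
  omega

lemma containsPattern_321_iff {n : ℕ} (π : Equiv.Perm (Fin n)) :
    ContainsPattern π [3, 2, 1] ↔ ∃ x y z, x < y ∧ y < z ∧ π y < π x ∧ π z < π y := by
  constructor
  · rintro ⟨f, hf, hw⟩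
    exact ⟨f (0 : Fin 3), f (1 : Fin 3), f (2 : Fin 3), hf (by decide : (0 : Fin 3) < 1),
      hf (by decide : (1 : Fin 3) < 2), (hw (1 : Fin 3) (0 : Fin 3)).1 (by decide),
      (hw (2 : Fin 3) (1 : Fin 3)).1 (by decide)⟩
  · rintro ⟨x, y, z, hxy, hyz, h1, h2⟩
    refine ⟨![x, y, z], ?_, ?_⟩
    · intro a b hab
      fin_cases a <;> fin_cases b <;> simp_all; order
    · intro a b
      fin_cases a <;> fin_cases b <;> simp <;> order

lemma avoids321Gon_insertMin_iff {k n : ℕ} (hk : 3 ≤ k) {p : Fin (n + 1)}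
    {σ : Equiv.Perm (Fin n)} (hp : (p : ℕ) < k - 1) (hinc : IncreasingPrefix p (insertMin p σ)) :
    Avoids321Gon k (insertMin p σ) ↔ Avoids321Gon k σ := by
  have hgon (a : ℕ) (ha : k ≤ a) (sep : Bool) :
      AvoidsPattern (insertMin p σ) (gonPattern k a sep) ↔
        AvoidsPattern σ (gonPattern k a sep) := by
    refine not_congr ⟨fun h => h.of_insertMin ?_, fun h => h.insertMin⟩
    rintro f hf hw c rfl
    have hc : k - 1 ≤ (c : ℕ) := gonPattern_min_position hk ha c fun b => by
      by_contra! hlt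
      rw [hw] at hlt
      simp at hlt
    have hle : ∀ i : ℕ, ∀ hi : i < (gonPattern k a sep).length, i ≤ (f ⟨i, hi⟩ : ℕ) := by
      intro i
      induction i with
      | zero => simp
      | succ i ih =>
        intro hi
        have h1 := ih (by omega)
        have h2 : f ⟨i, by omega⟩ < f ⟨i + 1, hi⟩ := hf (by simp)
        rw [Fin.lt_def] at h2
        omega
    have := hle c c.2
    simp at this
    omega
  have h321 : AvoidsPattern (insertMin p σ) [3, 2, 1] ↔ AvoidsPattern σ [3, 2, 1] := by
    refine not_congr ⟨fun h => ?_, fun h => h.insertMin⟩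
    obtain ⟨x, y, z, hxy, hyz, h1, h2⟩ := (containsPattern_321_iff _).1 h
    have hx : x ≠ p := by rintro rfl; simp at h1
    have hy : y ≠ p := by rintro rfl; simp at h2
    have hz : z ≠ p := by
      rintro rfl
      exact (hinc x y hxy hyz).not_gt h1
    obtain ⟨x, rfl⟩ := Fin.exists_succAbove_eq hx
    obtain ⟨y, rfl⟩ := Fin.exists_succAbove_eq hy
    obtain ⟨z, rfl⟩ := Fin.exists_succAbove_eq hz
    rw [containsPattern_321_iff]
    exact ⟨x, y, z, by simpa using hxy, by simpa using hyz, by simpa using h1, by simpa using h2⟩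
  simp only [Avoids321Gon, h321, hgon k le_rfl, hgon (k + 1) (by omega)]

section Increasing

variable {m n : ℕ}

lemma IncreasingPrefix.mono {m' : ℕ} {π : Equiv.Perm (Fin n)} (h : IncreasingPrefix m π)
    (hm : m' ≤ m) : IncreasingPrefix m' π :=
  fun i j hij hj => h i j hij (hj.trans_le hm)

lemma increasingPrefix_one (π : Equiv.Perm (Fin n)) : IncreasingPrefix 1 π := by
  intro i j hij hj
  rw [Fin.lt_def] at hij
  omega

lemma increasingPrefix_succ_iff {π : Equiv.Perm (Fin n)} (hm : m + 1 < n) :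
    IncreasingPrefix (m + 2) π ↔
      IncreasingPrefix (m + 1) π ∧ π ⟨m, by omega⟩ < π ⟨m + 1, hm⟩ := by
  refine ⟨fun h => ⟨h.mono (by omega), h _ _ (by simp) (by simp)⟩, fun ⟨h, hlt⟩ i j hij hj => ?_⟩
  rcases Nat.lt_or_ge j (m + 1) with hj' | hj'
  · exact h i j hij hj'
  · obtain rfl : j = ⟨m + 1, hm⟩ := Fin.ext (by simp; omega)
    rw [Fin.lt_def] at hij
    simp only at hij
    rcases Nat.lt_or_ge i m with hi | hi
    · exact (h i ⟨m, by omega⟩ hi (by simp)).trans hlt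
    · rwa [show i = ⟨m, by omega⟩ from Fin.ext (by simp; omega)]

lemma increasingPrefix_insertMin_zero_iff {σ : Equiv.Perm (Fin n)} :
    IncreasingPrefix (m + 1) (insertMin 0 σ) ↔ IncreasingPrefix m σ := by
  have hs (i : Fin n) : insertMin 0 σ i.succ = (σ i).succ := by
    simpa using insertMin_succAbove 0 σ i
  constructor
  · intro h i j hij hj
    simpa [hs] using h i.succ j.succ (by simpa) (by simpa)
  · intro h i j hij hj
    cases j using Fin.cases with
    | zero => simp at hij
    | succ j =>
      cases i using Fin.cases with
      | zero => simp [hs]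
      | succ i => simpa [hs] using h i j (by simpa using hij) (by simpa using hj)

lemma increasingPrefix_insertMin_iff {p : Fin (n + 1)} {σ : Equiv.Perm (Fin n)} :
    IncreasingPrefix p (insertMin p σ) ↔ IncreasingPrefix p σ := by
  have hs (i : Fin n) (hi : (i : ℕ) < p) : insertMin p σ i.castSucc = (σ i).succ := by
    rw [← insertMin_succAbove p, Fin.succAbove_of_castSucc_lt _ _ (by simpa [Fin.lt_def])]
  constructor
  · intro h i j hij hj
    have := h i.castSucc j.castSucc (by simpa) (by simpa)
    rwa [hs i (lt_trans hij hj), hs j hj, Fin.succ_lt_succ_iff] at this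
  · intro h i j hij hj
    have hij' : (i : ℕ) < j := hij
    obtain ⟨i, rfl⟩ : ∃ i' : Fin n, i'.castSucc = i := ⟨⟨i, by omega⟩, rfl⟩
    obtain ⟨j, rfl⟩ : ∃ j' : Fin n, j'.castSucc = j := ⟨⟨j, by omega⟩, rfl⟩
    rw [hs i (lt_trans hij hj), hs j hj, Fin.succ_lt_succ_iff]
    exact h i j hij hj

end Increasing

open Classical in
/-- Insert a new minimal entry either at the front or after the first `m + 1` entries, so that the
first descent of the result is at position `m + 1`, given that the first `m` entries increase. -/
noncomputable def insertDescent {m n : ℕ} (hm : m + 1 < n + 1) (σ : Equiv.Perm (Fin n)) :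
    Equiv.Perm (Fin (n + 1)) :=
  if IncreasingPrefix (m + 1) σ then insertMin ⟨m + 1, hm⟩ σ else insertMin 0 σ

lemma insertDescent_injective {m n : ℕ} (hm : m + 1 < n + 1) :
    Function.Injective (insertDescent (n := n) hm) := by
  intro σ τ h
  have hne : ∀ σ τ : Equiv.Perm (Fin n), insertMin ⟨m + 1, hm⟩ σ ≠ insertMin 0 τ := by
    intro σ τ h
    have h0 : insertMin ⟨m + 1, hm⟩ σ 0 = 0 := by rw [h, insertMin_self]
    have := eq_of_insertMin_apply_eq_zero _ _ h0
    simp [Fin.ext_iff] at this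
  unfold insertDescent at h
  split_ifs at h
  · exact insertMin_injective _ h
  · exact absurd h (hne _ _)
  · exact absurd h.symm (hne _ _)
  · exact insertMin_injective _ h

lemma insertDescent_spec {k m n : ℕ} (hk : 3 ≤ k) (hmk : m + 2 ≤ k - 1) (hm : m + 1 < n + 1)
    {σ : Equiv.Perm (Fin n)} (hσ : Avoids321Gon k σ) (hinc : IncreasingPrefix m σ) :
    Avoids321Gon k (insertDescent hm σ) ∧ IncreasingPrefix (m + 1) (insertDescent hm σ) ∧
      ¬ IncreasingPrefix (m + 2) (insertDescent hm σ) := by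
  unfold insertDescent
  split_ifs with h
  · have hpre : IncreasingPrefix (m + 1) (insertMin ⟨m + 1, hm⟩ σ) :=
      (increasingPrefix_insertMin_iff (p := ⟨m + 1, hm⟩)).2 h
    refine ⟨(avoids321Gon_insertMin_iff hk (by simp; omega) hpre).2 hσ, hpre, fun h' => ?_⟩
    simpa using ((increasingPrefix_succ_iff hm).1 h').2
  · refine ⟨(avoids321Gon_insertMin_iff hk (by simp; omega) ?_).2 hσ,
      increasingPrefix_insertMin_zero_iff.2 hinc,
      fun h' => h (increasingPrefix_insertMin_zero_iff.1 h')⟩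
    exact fun i j _ hj => absurd hj (by simp)

lemma exists_insertDescent_eq {k m n : ℕ} (hk : 3 ≤ k) (hmk : m + 2 ≤ k - 1) (hm : m + 1 < n + 1)
    {π : Equiv.Perm (Fin (n + 1))} (hπ : Avoids321Gon k π) (hinc : IncreasingPrefix (m + 1) π)
    (hdesc : ¬ IncreasingPrefix (m + 2) π) :
    ∃ σ, (Avoids321Gon k σ ∧ IncreasingPrefix m σ) ∧ insertDescent hm σ = π := by
  have hlt : π ⟨m + 1, hm⟩ < π ⟨m, by omega⟩ := by
    have h := fun h => hdesc ((increasingPrefix_succ_iff hm).2 ⟨hinc, h⟩)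
    refine lt_of_le_of_ne (not_lt.1 h) fun h => ?_
    simpa using π.injective h
  obtain ⟨p, hp⟩ := π.surjective 0
  have hcases : p = 0 ∨ p = ⟨m + 1, hm⟩ := by
    by_contra! hne
    rcases Nat.lt_or_ge p (m + 1) with h | h
    · have := hinc 0 p (Fin.pos_of_ne_zero hne.1) h
      simp [hp] at this
    · refine hπ.1 ((containsPattern_321_iff π).2 ⟨⟨m, by omega⟩, ⟨m + 1, hm⟩, p, by simp,
        lt_of_le_of_ne h hne.2.symm, hlt, ?_⟩)
      rw [hp, Fin.pos_iff_ne_zero, ← hp]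
      exact fun h => hne.2 (π.injective h).symm
  obtain ⟨σ, rfl⟩ := exists_insertMin_eq p π hp
  rcases hcases with rfl | rfl
  · have hσ : ¬ IncreasingPrefix (m + 1) σ :=
      fun h => hdesc (increasingPrefix_insertMin_zero_iff.2 h)
    refine ⟨σ, ⟨(avoids321Gon_insertMin_iff hk (by simp; omega) ?_).1 hπ,
      increasingPrefix_insertMin_zero_iff.1 hinc⟩, by simp [insertDescent, hσ]⟩
    exact fun i j _ hj => absurd hj (by simp)
  · have hσ : IncreasingPrefix (m + 1) σ :=
      (increasingPrefix_insertMin_iff (p := ⟨m + 1, hm⟩)).1 hinc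
    exact ⟨σ, ⟨(avoids321Gon_insertMin_iff hk (by simp; omega) hinc).1 hπ, hσ.mono (by omega)⟩,
      by simp [insertDescent, hσ]⟩

lemma incCount_eq_fgon {k n m : ℕ} (hm : m ≤ 1) : incCount k n m = fgon k n := by
  have h (π : Equiv.Perm (Fin n)) : IncreasingPrefix m π := (increasingPrefix_one π).mono hm
  simp [incCount, fgon, h]

lemma incCount_recurrence {k m n : ℕ} (hk : 3 ≤ k) (hmk : m + 2 ≤ k - 1) (hm : m + 1 < n + 1) :
    incCount k (n + 1) (m + 1) = incCount k (n + 1) (m + 2) + incCount k n m := by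
  let S (n m : ℕ) : Set (Equiv.Perm (Fin n)) := {π | Avoids321Gon k π ∧ IncreasingPrefix m π}
  have hcount (n m : ℕ) : incCount k n m = (S n m).ncard := rfl
  have hsub : S (n + 1) (m + 2) ⊆ S (n + 1) (m + 1) := fun π h => ⟨h.1, h.2.mono (by omega)⟩
  have himage : S (n + 1) (m + 1) \ S (n + 1) (m + 2) = insertDescent hm '' S n m := by
    ext π
    constructor
    · rintro ⟨⟨h1, h2⟩, h3⟩
      exact exists_insertDescent_eq hk hmk hm h1 h2 fun h => h3 ⟨h1, h⟩
    · rintro ⟨σ, ⟨h1, h2⟩, rfl⟩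
      obtain ⟨h3, h4, h5⟩ := insertDescent_spec hk hmk hm h1 h2
      exact ⟨⟨h3, h4⟩, fun h => h5 h.2⟩
  rw [hcount, hcount, hcount, ← Set.ncard_image_of_injective _ (insertDescent_injective hm),
    ← himage, add_comm (Set.ncard _), Set.ncard_sdiff_add_ncard_of_subset hsub]

lemma Lgon_recurrence (k n m : ℕ) :
    Lgon k (n + 1) (m + 2) = Lgon k (n + 1) (m + 1) - Lgon k n m := by
  have h1 : Lgon k (n + 1) (m + 1) = ∑ j ∈ Finset.range (m + 3),
      (-1 : ℤ) ^ j * ((m + 1 - j).choose j : ℤ) * (fgon k (n + 1 - j) : ℤ) := by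
    rw [Lgon, Finset.sum_range_succ _ (m + 2)]
    simp
  have h2 : Lgon k n m = ∑ j ∈ Finset.range (m + 2),
      (-1 : ℤ) ^ j * ((m - j).choose j : ℤ) * (fgon k (n - j) : ℤ) := by
    rw [Lgon, Finset.sum_range_succ _ (m + 1)]
    simp
  rw [h1, h2, Lgon, Finset.sum_range_succ' _ (m + 2), Finset.sum_range_succ' _ (m + 2),
    add_sub_right_comm, ← Finset.sum_sub_distrib]
  congr 1
  · refine Finset.sum_congr rfl fun j hj => ?_
    have hj' : j < m + 2 := Finset.mem_range.1 hj
    have hchoose : (m + 2 - (j + 1)).choose (j + 1) =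
        (m - j).choose j + (m + 1 - (j + 1)).choose (j + 1) := by
      rcases Nat.lt_or_ge m j with h | h
      · obtain rfl : j = m + 1 := by omega
        simp
      · rw [show m + 2 - (j + 1) = (m - j) + 1 by omega, show m + 1 - (j + 1) = m - j by omega,
          Nat.choose_succ_succ]
    rw [hchoose, show n + 1 - (j + 1) = n - j by omega]
    push_cast
    ring

lemma incCount_eq_Lgon {k : ℕ} (hk : 3 ≤ k) (m : ℕ) :
    ∀ n, m ≤ k - 1 → m ≤ n → (incCount k n m : ℤ) = Lgon k n m := by
  induction m using Nat.twoStepInduction with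
  | zero => intro n _ _; simp [incCount_eq_fgon, Lgon]
  | one => intro n _ _; simp [incCount_eq_fgon, Lgon, Finset.sum_range_succ]
  | more m ih0 ih1 =>
    intro n hmk hmn
    obtain ⟨n, rfl⟩ : ∃ n', n = n' + 1 := ⟨n - 1, by omega⟩
    rw [Lgon_recurrence, ← ih0 n (by omega) (by omega), ← ih1 (n + 1) (by omega) (by omega),
      incCount_recurrence hk hmk (by omega)]
    push_cast
    ring

/-- The list of the first `m` entries of `π`, with values in `{1,…,n}`. -/
def prefixList {m n : ℕ} (hm : m ≤ n) (π : Equiv.Perm (Fin n)) : List ℕ :=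
  List.ofFn fun i : Fin m => (π (Fin.castLE hm i) : ℕ) + 1

lemma startsWith_iff {m n : ℕ} (hm : m ≤ n) (π : Equiv.Perm (Fin n)) {l : List ℕ}
    (hl : l.length = m) : StartsWith π l ↔ l = prefixList hm π := by
  subst hl
  constructor
  · intro h
    refine List.ext_getElem (by simp [prefixList]) fun i h1 h2 => ?_
    simpa [prefixList] using (h ⟨i, h1⟩ (by simp; omega)).symm
  · intro h j hj
    have hj' : (j : ℕ) < (prefixList hm π).length := by simp [prefixList]
    have : l.get j = (prefixList hm π)[(j : ℕ)] := by
      rw [List.get_eq_getElem]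
      exact List.getElem_of_eq h _
    rw [this]
    simp [prefixList, Fin.castLE]

lemma sortedLT_prefixList_iff {m n : ℕ} (hm : m ≤ n) (π : Equiv.Perm (Fin n)) :
    (prefixList hm π).SortedLT ↔ IncreasingPrefix m π := by
  rw [prefixList, List.sortedLT_ofFn_iff]
  constructor
  · intro h i j hij hj
    have := h (a := ⟨i, lt_trans hij hj⟩) (b := ⟨j, hj⟩) hij
    simpa using this
  · intro h i j hij
    simpa using h (Fin.castLE hm i) (Fin.castLE hm j) (by simpa) (by simp)

lemma Aseq_one_eq_incCount {k m n : ℕ} (hm : m ≤ n) : Aseq k 1 n m = incCount k n m := by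
  classical
  set T : Finset (Equiv.Perm (Fin n)) :=
    Finset.univ.filter fun π => Avoids321Gon k π ∧ IncreasingPrefix m π with hT
  have hmaps : ∀ π ∈ T, (prefixList hm π).toFinset ∈ (Finset.Icc 1 n).powersetCard m := by
    intro π hπ
    have hsort := (sortedLT_prefixList_iff hm π).2 (Finset.mem_filter.1 hπ).2.2
    rw [Finset.mem_powersetCard, List.toFinset_card_of_nodup hsort.nodup]
    refine ⟨fun x hx => ?_, by simp [prefixList]⟩
    simp only [prefixList, List.mem_toFinset, List.mem_ofFn] at hx
    obtain ⟨i, rfl⟩ := hx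
    simp
  have hcard : incCount k n m = T.card := by
    rw [incCount, Nat.card_eq_fintype_card, Fintype.card_subtype]
  rw [hcard, Finset.card_eq_sum_card_fiberwise hmaps, Aseq]
  refine Finset.sum_congr rfl fun s hs => ?_
  rw [fstart, Nat.card_eq_fintype_card, Fintype.card_subtype]
  congr 1
  ext π
  have hlen : (s.sort (· ≤ ·)).length = m := by
    rw [Finset.length_sort, (Finset.mem_powersetCard.1 hs).2]
  simp only [hT, Finset.mem_filter, Finset.mem_univ, true_and, startsWith_iff hm π hlen, and_assoc]
  refine and_congr_right fun _ => ?_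
  rw [← sortedLT_prefixList_iff hm]
  constructor
  · intro h
    rw [← h]
    exact ⟨Finset.sortedLT_sort s, Finset.sort_toFinset s _⟩
  · rintro ⟨h1, rfl⟩
    exact (List.toFinset_sort _ h1.nodup).2 h1.sortedLE.pairwise

/-- For `k ≥ 3` and `1 ≤ m ≤ min{k−1, n}`:
`A_1(n, m) = Σ_{j=0}^{m} (−1)^j C(m−j, j) f_k(n−j)`. -/
theorem Aseq_one (k n m : ℕ) (hk : 3 ≤ k) (hm1 : 1 ≤ m) (hm2 : m ≤ k - 1) (hm3 : m ≤ n) :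
    (Aseq k 1 n m : ℤ) =
      ∑ j ∈ Finset.range (m+1), (-1 : ℤ)^j * ((m-j).choose j : ℤ) * (fgon k (n-j) : ℤ) := by
  rw [Aseq_one_eq_incCount hm3]
  exact incCount_eq_Lgon hk m n hm2 hm3
end

section
/- Let k ≥ 3 and n ≥ k−1. Then C_k(n, k−1) = C_{k−1}(n−1, k−1) + A_{k−1}(n−3, k−2). -/
/-- The `i`-th entry (0-indexed) of `gonPattern k a sep`. -/
def gonEntry (k a : ℕ) (sep : Bool) (i : ℕ) : ℕ :=
  if i = 0 then a
  else if i + 1 < k then k + 1 + i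
  else if i + 1 = 2 * k then 2 * k + 1 - a
  else if i + 1 = k then (if sep then 1 else 2 * k)
  else if i = k ∧ sep then 2 * k
  else i + 1 - k

theorem gonPattern_eq_append (k a : ℕ) (sep : Bool) (hk : 3 ≤ k) (ha : a = k ∨ a = k + 1) :
    gonPattern k a sep = a :: (List.range' (k+2) (k-2) ++ (if sep then [1, 2*k] else [2*k])) ++
      ((if sep then List.range' 2 (k-2) else List.range' 1 (k-1)) ++ [2 * k + 1 - a]) := by
  unfold gonPattern
  simp only
  congr 1
  refine List.Pairwise.eq_of_mem_iff (r := (· < ·)) ?_ ?_ ?_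
  · exact List.Pairwise.filter _ List.pairwise_lt_range'
  · rw [List.pairwise_append]
    refine ⟨by split_ifs <;> exact List.pairwise_lt_range', by simp, ?_⟩
    intro x hx y hy
    cases sep <;> simp at hx hy <;> omega
  · intro x
    cases sep <;> simp <;> omega

theorem gonPattern_getElem (k a : ℕ) (sep : Bool) (hk : 3 ≤ k) (ha : a = k ∨ a = k + 1) :
    (gonPattern k a sep).length = 2 * k ∧
    ∀ (i : ℕ) (h : i < (gonPattern k a sep).length),
      (gonPattern k a sep)[i] = gonEntry k a sep i := by
  rw [gonPattern_eq_append k a sep hk ha]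
  constructor
  · cases sep <;> simp <;> omega
  · intro i h
    unfold gonEntry
    cases sep
    · simp at h
      simp only [List.getElem_append, List.getElem_cons, List.getElem_range']
      simp
      split_ifs <;> omega
    · simp at h
      simp only [List.getElem_append, List.getElem_cons, List.getElem_range', if_true]
      simp
      split_ifs <;> omega

/-- `π` has an occurrence of the word `u 0, …, u (N - 1)`. -/
def HasOcc {n : ℕ} (π : Equiv.Perm (Fin n)) (N : ℕ) (u : ℕ → ℕ) : Prop :=
  ∃ f : Fin N → Fin n, StrictMono f ∧ ∀ x y : Fin N, u x < u y ↔ π (f x) < π (f y)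

theorem containsPattern_iff_hasOcc {n : ℕ} (π : Equiv.Perm (Fin n)) (w : List ℕ) (N : ℕ)
    (u : ℕ → ℕ) (hN : w.length = N) (hu : ∀ (i : ℕ) (h : i < w.length), w[i] = u i) :
    ContainsPattern π w ↔ HasOcc π N u := by
  subst hN
  simp [ContainsPattern, HasOcc, hu]

theorem hasOcc_321_iff {n : ℕ} (π : Equiv.Perm (Fin n)) :
    HasOcc π 3 (fun i => 3 - i) ↔ ∃ i j l, i < j ∧ j < l ∧ π l < π j ∧ π j < π i := by
  constructor
  · rintro ⟨f, hf, h⟩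
    exact ⟨f 0, f 1, f 2, hf (by decide), hf (by decide), (h 2 1).1 (by decide),
      (h 1 0).1 (by decide)⟩
  · rintro ⟨i, j, l, hij, hjl, h1, h2⟩
    refine ⟨![i, j, l], ?_, ?_⟩
    · rw [Fin.strictMono_iff_lt_succ]
      intro x
      fin_cases x <;> simpa
    · intro x y
      fin_cases x <;> fin_cases y <;> simp <;> order

theorem avoids321Gon_iff {n : ℕ} (k : ℕ) (hk : 3 ≤ k) (π : Equiv.Perm (Fin n)) :
    Avoids321Gon k π ↔ (¬ ∃ i j l, i < j ∧ j < l ∧ π l < π j ∧ π j < π i) ∧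
      ∀ a sep, (a = k ∨ a = k + 1) → ¬ HasOcc π (2 * k) (gonEntry k a sep) := by
  have key : ∀ a sep, (a = k ∨ a = k + 1) →
      (AvoidsPattern π (gonPattern k a sep) ↔ ¬ HasOcc π (2 * k) (gonEntry k a sep)) := by
    intro a sep ha
    have := gonPattern_getElem k a sep hk ha
    rw [AvoidsPattern, containsPattern_iff_hasOcc π _ _ _ this.1 this.2]
  have h321 : AvoidsPattern π [3, 2, 1] ↔ ¬ HasOcc π 3 (fun i => 3 - i) := by
    rw [AvoidsPattern, containsPattern_iff_hasOcc π _ 3 (fun i => 3 - i) rfl]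
    intro i h
    simp at h
    interval_cases i <;> rfl
  rw [Avoids321Gon, h321, hasOcc_321_iff, key k true (by simp), key k false (by simp),
    key (k+1) true (by simp), key (k+1) false (by simp)]
  constructor
  · rintro ⟨h, h1, h2, h3, h4⟩
    refine ⟨h, ?_⟩
    rintro a sep (rfl | rfl) <;> cases sep <;> assumption
  · rintro ⟨h, h'⟩
    exact ⟨h, h' _ _ (by simp), h' _ _ (by simp), h' _ _ (by simp), h' _ _ (by simp)⟩

theorem HasOcc.map {m n N : ℕ} {u : ℕ → ℕ} {σ : Equiv.Perm (Fin m)} {π : Equiv.Perm (Fin n)}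
    {g : Fin m → Fin n} (hg : StrictMono g) (h : ∀ i j, σ i < σ j ↔ π (g i) < π (g j))
    (ho : HasOcc σ N u) : HasOcc π N u := by
  obtain ⟨f, hf, hu⟩ := ho
  exact ⟨g ∘ f, hg.comp hf, fun x y => by rw [hu, h]; rfl⟩

theorem HasOcc.of_range_subset {m n N : ℕ} {u : ℕ → ℕ} {σ : Equiv.Perm (Fin m)}
    {π : Equiv.Perm (Fin n)} {g : Fin m → Fin n} (hg : StrictMono g)
    (h : ∀ i j, σ i < σ j ↔ π (g i) < π (g j)) {f : Fin N → Fin n} (hf : StrictMono f)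
    (hu : ∀ x y : Fin N, u x < u y ↔ π (f x) < π (f y)) (hr : ∀ x, ∃ i, g i = f x) :
    HasOcc σ N u := by
  choose f' hf' using hr
  refine ⟨f', fun x y hxy => ?_, fun x y => by rw [hu, h, hf', hf']⟩
  rw [← hg.lt_iff_lt, hf', hf']
  exact hf hxy

theorem Avoids321Gon.of_map {m n k : ℕ} (hk : 3 ≤ k) {σ : Equiv.Perm (Fin m)}
    {π : Equiv.Perm (Fin n)} {g : Fin m → Fin n} (hg : StrictMono g)
    (h : ∀ i j, σ i < σ j ↔ π (g i) < π (g j)) (ha : Avoids321Gon k π) : Avoids321Gon k σ := by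
  rw [avoids321Gon_iff k hk] at ha ⊢
  refine ⟨?_, fun a sep hs ho => ha.2 a sep hs (ho.map hg h)⟩
  rintro ⟨i, j, l, hij, hjl, h1, h2⟩
  exact ha.1 ⟨g i, g j, g l, hg hij, hg hjl, (h _ _).1 h1, (h _ _).1 h2⟩

theorem gonEntry_injOn {k a : ℕ} (sep : Bool) (ha : a = k ∨ a = k + 1) {x y : ℕ}
    (hk : 3 ≤ k) (hx : x < 2 * k) (hy : y < 2 * k)
    (h : gonEntry k a sep x = gonEntry k a sep y) : x = y := by
  unfold gonEntry at h
  cases sep <;> simp at h <;> split_ifs at h <;> omega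

theorem exists_gonEntry_eq {k a : ℕ} (sep : Bool) (ha : a = k ∨ a = k + 1) (hk : 3 ≤ k)
    {r : ℕ} (hr : 1 ≤ r) (hr' : r ≤ 2 * k) : ∃ x < 2 * k, gonEntry k a sep x = r := by
  by_cases h1 : r = a
  · exact ⟨0, by omega, by simp [gonEntry, h1]⟩
  by_cases h2 : r = 2 * k + 1 - a
  · refine ⟨2 * k - 1, by omega, ?_⟩
    unfold gonEntry
    split_ifs <;> omega
  by_cases h3 : r = 2 * k
  · cases sep
    · refine ⟨k - 1, by omega, ?_⟩
      unfold gonEntry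
      simp
      split_ifs <;> omega
    · refine ⟨k, by omega, ?_⟩
      unfold gonEntry
      simp
      split_ifs <;> omega
  by_cases h4 : k < r
  · refine ⟨r - k - 1, by omega, ?_⟩
    unfold gonEntry
    split_ifs <;> omega
  by_cases h5 : r = 1 ∧ sep
  · refine ⟨k - 1, by omega, ?_⟩
    unfold gonEntry
    simp [h5]
    split_ifs <;> omega
  · refine ⟨r + k - 1, by omega, ?_⟩
    unfold gonEntry
    split_ifs <;> first | omega | (simp_all; omega)

theorem gonEntry_pos {k a : ℕ} (sep : Bool) (ha : a = k ∨ a = k + 1) (hk : 3 ≤ k) {x : ℕ}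
    (hx : x < 2 * k) : 1 ≤ gonEntry k a sep x ∧ gonEntry k a sep x ≤ 2 * k := by
  unfold gonEntry
  split_ifs <;> omega

/-- If all values of an occurrence are at least `c`, then the value playing the role of `r` is at
least `c + r - 1`. -/
theorem gonEntry_le_of_occ {n k a : ℕ} {sep : Bool} (ha : a = k ∨ a = k + 1) (hk : 3 ≤ k)
    {π : Equiv.Perm (Fin n)} {f : Fin (2 * k) → Fin n}
    (hu : ∀ x y : Fin (2 * k), gonEntry k a sep x < gonEntry k a sep y ↔ π (f x) < π (f y))
    {c : ℕ} (hc : ∀ x, c ≤ (π (f x) : ℕ)) (x : Fin (2 * k)) :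
    c + gonEntry k a sep x ≤ (π (f x) : ℕ) + 1 := by
  have key : ∀ r, ∀ x : Fin (2 * k), gonEntry k a sep x = r → c + r ≤ (π (f x) : ℕ) + 1 := by
    intro r
    induction r with
    | zero => intro x _; have := hc x; omega
    | succ r ih =>
      intro x hx
      by_cases hr : r = 0
      · have := hc x; omega
      have hx' := gonEntry_pos sep ha hk x.2
      obtain ⟨y, hy, hyr⟩ := exists_gonEntry_eq sep ha hk (r := r) (by omega) (by omega)
      have h1 := ih ⟨y, hy⟩ hyr
      have h2 := (hu ⟨y, hy⟩ x).1 (by simp only; omega)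
      rw [Fin.lt_def] at h2
      omega
  exact key _ x rfl

/-- In an occurrence using the value `0`, that value plays the role of `1`. -/
theorem gonEntry_eq_one_of_occ {n k a : ℕ} {sep : Bool} (ha : a = k ∨ a = k + 1) (hk : 3 ≤ k)
    {π : Equiv.Perm (Fin n)} {f : Fin (2 * k) → Fin n}
    (hu : ∀ x y : Fin (2 * k), gonEntry k a sep x < gonEntry k a sep y ↔ π (f x) < π (f y))
    {x : Fin (2 * k)} (hx : (π (f x) : ℕ) = 0) : (x : ℕ) = if sep then k - 1 else k := by
  have h := gonEntry_le_of_occ ha hk hu (c := 0) (fun _ => Nat.zero_le _) x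
  have hp := gonEntry_pos sep ha hk x.2
  apply gonEntry_injOn sep ha hk x.2 (by split_ifs <;> omega)
  rw [show gonEntry k a sep x = 1 by omega]
  unfold gonEntry
  cases sep <;> simp <;> split_ifs <;> omega

theorem StrictMono.val_le_apply_fin {N n : ℕ} {f : Fin N → Fin n} (hf : StrictMono f)
    (x : Fin N) : (x : ℕ) ≤ f x := by
  obtain ⟨x, hx⟩ := x
  induction x with
  | zero => simp
  | succ x ih =>
    have h1 := ih (by omega)
    have h2 : f ⟨x, by omega⟩ < f ⟨x + 1, hx⟩ := hf (by simp)
    rw [Fin.lt_def] at h2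
    simp only at *
    omega

/-- `π` begins with `m` increasing entries, all at least `d` in 1-indexed notation. -/
def StartsInc {n : ℕ} (d m : ℕ) (π : Equiv.Perm (Fin n)) : Prop :=
  (∀ i j : Fin n, i < j → (j : ℕ) < m → π i < π j) ∧
    ∀ i : Fin n, (i : ℕ) < m → d ≤ (π i : ℕ) + 1

/-- The set of the first `m` entries of `π`, 1-indexed. -/
def initialValues {n : ℕ} (m : ℕ) (π : Equiv.Perm (Fin n)) : Finset ℕ :=
  (Finset.univ.filter (fun i : Fin n => (i : ℕ) < m)).image (fun i => (π i : ℕ) + 1)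

theorem initialValues_mem_powersetCard {n d m : ℕ} (hm : m ≤ n) {π : Equiv.Perm (Fin n)}
    (h : StartsInc d m π) : initialValues m π ∈ (Finset.Icc d n).powersetCard m := by
  rw [Finset.mem_powersetCard]
  constructor
  · intro x hx
    simp only [initialValues, Finset.mem_image, Finset.mem_filter, Finset.mem_univ, true_and] at hx
    obtain ⟨i, hi, rfl⟩ := hx
    have := h.2 i hi
    simp only [Finset.mem_Icc]
    omega
  · rw [initialValues, Finset.card_image_of_injective]
    · rw [Fin.card_filter_val_lt]
      simpa using hm
    · intro i j hij
      exact π.injective (Fin.ext (by simpa using hij))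

theorem startsWith_sort_iff {n d m : ℕ} (hm : m ≤ n) {s : Finset ℕ}
    (hs : s ∈ (Finset.Icc d n).powersetCard m) (π : Equiv.Perm (Fin n)) :
    StartsWith π (s.sort (· ≤ ·)) ↔ StartsInc d m π ∧ initialValues m π = s := by
  rw [Finset.mem_powersetCard] at hs
  have hl : (s.sort (· ≤ ·)).length = m := by simp [hs.2]
  constructor
  · intro h
    have hv : ∀ (i : Fin n) (hi : (i : ℕ) < m),
        (π i : ℕ) + 1 = (s.sort (· ≤ ·))[(i : ℕ)]'(by omega) := fun i hi =>
      h ⟨i, by omega⟩ i.2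
    refine ⟨⟨fun i j hij hj => ?_, fun i hi => ?_⟩, ?_⟩
    · have h1 := hv i (by omega)
      have h2 := hv j hj
      have h3 := List.pairwise_iff_getElem.1 s.sortedLT_sort.pairwise i j (by omega) (by omega) hij
      rw [Fin.lt_def]
      omega
    · have h1 := hv i hi
      have h2 : (s.sort (· ≤ ·))[(i : ℕ)]'(by omega) ∈ s :=
        (Finset.mem_sort _).1 (List.getElem_mem _)
      have h3 := hs.1 h2
      rw [Finset.mem_Icc] at h3
      omega
    · ext x
      simp only [initialValues, Finset.mem_image, Finset.mem_filter, Finset.mem_univ, true_and]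
      rw [← Finset.mem_sort (· ≤ ·), List.mem_iff_getElem]
      constructor
      · rintro ⟨i, hi, rfl⟩
        exact ⟨i, by omega, (hv i hi).symm⟩
      · rintro ⟨i, hi, rfl⟩
        exact ⟨⟨i, by omega⟩, by simp only; omega, hv ⟨i, by omega⟩ (by simp only; omega)⟩
  · rintro ⟨h, rfl⟩
    have he : (initialValues m π).sort (· ≤ ·) =
        List.ofFn (fun j : Fin m => (π ⟨j, by omega⟩ : ℕ) + 1) := by
      refine List.Pairwise.eq_of_mem_iff (r := (· < ·))
        (Finset.sortedLT_sort _).pairwise ?_ ?_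
      · rw [List.pairwise_ofFn]
        intro i j hij
        have := h.1 ⟨i, by omega⟩ ⟨j, by omega⟩ hij j.2
        rw [Fin.lt_def] at this
        omega
      · intro x
        simp only [Finset.mem_sort, initialValues, Finset.mem_image, Finset.mem_filter,
          Finset.mem_univ, true_and, List.mem_ofFn]
        constructor
        · rintro ⟨i, hi, rfl⟩
          exact ⟨⟨i, hi⟩, rfl⟩
        · rintro ⟨i, rfl⟩
          exact ⟨⟨i, by omega⟩, i.2, rfl⟩
    rw [he]
    intro j hj
    simp

theorem sum_card_startsWith {n d m : ℕ} (hm : m ≤ n) (P : Equiv.Perm (Fin n) → Prop) :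
    ∑ s ∈ (Finset.Icc d n).powersetCard m,
      Nat.card {π : Equiv.Perm (Fin n) // P π ∧ StartsWith π (s.sort (· ≤ ·))} =
    Nat.card {π : Equiv.Perm (Fin n) // P π ∧ StartsInc d m π} := by
  classical
  rw [Nat.card_eq_fintype_card, Fintype.card_subtype,
    Finset.card_eq_sum_card_fiberwise (f := initialValues m)
      (t := (Finset.Icc d n).powersetCard m)]
  · refine Finset.sum_congr rfl fun s hs => ?_
    rw [Nat.card_eq_fintype_card, Fintype.card_subtype, Finset.filter_filter]
    congr 1
    ext π
    simp only [Finset.mem_filter, Finset.mem_univ, true_and, startsWith_sort_iff hm hs, and_assoc]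
  · intro π hπ
    simp only [Finset.coe_filter, Finset.mem_univ, true_and, Set.mem_ofPred_eq] at hπ
    exact initialValues_mem_powersetCard hm hπ.2

theorem Aseq_eq_card {k d n m : ℕ} (hm : m ≤ n) :
    Aseq k d n m = Nat.card {π : Equiv.Perm (Fin n) // Avoids321Gon k π ∧ StartsInc d m π} :=
  sum_card_startsWith hm _

theorem startsWith_append_singleton {n : ℕ} (π : Equiv.Perm (Fin n)) (l : List ℕ)
    (hl : l.length < n) : StartsWith π (l ++ [1]) ↔
      (π ⟨l.length, hl⟩ : ℕ) = 0 ∧ StartsWith π l := by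
  constructor
  · intro h
    constructor
    · have := h ⟨l.length, by simp⟩ hl
      simpa using this
    · intro j hj
      have := h ⟨j, by simp⟩ hj
      simpa [List.getElem_append] using this
  · rintro ⟨h0, h⟩ ⟨j, hj⟩ hjn
    simp at hj
    by_cases hjl : j < l.length
    · have := h ⟨j, hjl⟩ hjn
      simpa [List.getElem_append, hjl] using this
    · have : j = l.length := by omega
      subst this
      simp [h0]

theorem Cseq_eq_card {k d n m : ℕ} (hm : m < n) :
    Cseq k d n m = Nat.card {π : Equiv.Perm (Fin n) //
      (Avoids321Gon k π ∧ (π ⟨m, hm⟩ : ℕ) = 0) ∧ StartsInc d m π} := by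
  rw [← sum_card_startsWith hm.le]
  refine Finset.sum_congr rfl fun s hs => ?_
  have hl : (s.sort (· ≤ ·)).length = m := by simp [(Finset.mem_powersetCard.1 hs).2]
  refine Nat.card_congr (Equiv.subtypeEquivRight fun π => ?_)
  subst hl
  rw [startsWith_append_singleton π _ hm, and_assoc]

/-- The permutation with value `q` at position `p` whose other entries are order-isomorphic
to `σ`. -/
def insertPerm {n : ℕ} (p q : Fin (n + 1)) (σ : Equiv.Perm (Fin n)) :
    Equiv.Perm (Fin (n + 1)) :=
  (finSuccEquiv' p).trans ((Equiv.optionCongr σ).trans (finSuccEquiv' q).symm)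

theorem insertPerm_same {n : ℕ} (p q : Fin (n + 1)) (σ : Equiv.Perm (Fin n)) :
    insertPerm p q σ p = q := by
  simp [insertPerm]

theorem insertPerm_succAbove {n : ℕ} (p q : Fin (n + 1)) (σ : Equiv.Perm (Fin n)) (i : Fin n) :
    insertPerm p q σ (p.succAbove i) = q.succAbove (σ i) := by
  simp [insertPerm]

theorem insertPerm_injective {n : ℕ} (p q : Fin (n + 1)) :
    Function.Injective (insertPerm p q) := by
  intro σ τ h
  ext i : 1
  have := DFunLike.congr_fun h (p.succAbove i)
  rw [insertPerm_succAbove, insertPerm_succAbove] at this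
  exact Fin.succAbove_right_injective this

theorem exists_insertPerm_eq {n : ℕ} {p q : Fin (n + 1)} {π : Equiv.Perm (Fin (n + 1))}
    (h : π p = q) : ∃ σ, insertPerm p q σ = π := by
  let e : Option (Fin n) ≃ Option (Fin n) :=
    (finSuccEquiv' p).symm.trans (π.trans (finSuccEquiv' q))
  refine ⟨Equiv.removeNone e, ?_⟩
  ext i : 1
  rcases Fin.eq_self_or_eq_succAbove p i with rfl | ⟨j, rfl⟩
  · rw [insertPerm_same, h]
  · have hne : π (p.succAbove j) ≠ q := by
      rw [← h]
      exact fun h' => Fin.succAbove_ne p j (π.injective h')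
    obtain ⟨l, hl⟩ := Fin.exists_succAbove_eq hne
    have he : e (some j) = some l := by simp [e, ← hl]
    have := Equiv.removeNone_some e ⟨l, he⟩
    rw [he] at this
    rw [insertPerm_succAbove, Option.some_injective _ this, hl]

/-- Inserting a new minimum right before an initial minimum at position `k - 1` preserves
avoidance. -/
theorem Avoids321Gon.insertPerm_zero {n k : ℕ} (hk : 3 ≤ k) (hn : k - 1 < n)
    {σ : Equiv.Perm (Fin n)} (h0 : (σ ⟨k - 1, hn⟩ : ℕ) = 0) (h : Avoids321Gon k σ) :
    Avoids321Gon k (insertPerm ⟨k - 1, by omega⟩ 0 σ) := by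
  set p : Fin (n + 1) := ⟨k - 1, by omega⟩ with hp
  set q : Fin (n + 1) := ⟨k, by omega⟩ with hq
  set π := insertPerm p 0 σ with hπ
  have hpv : π p = 0 := insertPerm_same _ _ _
  have hsv : ∀ i, π (p.succAbove i) = (σ i).succ := fun i => by
    rw [hπ, insertPerm_succAbove, Fin.succAbove_zero]
  have hqp : p.succAbove ⟨k - 1, hn⟩ = q := by
    rw [Fin.succAbove_of_le_castSucc _ _ (by simp [hp])]
    ext
    simp [hq]
    omega
  have hqv : (π q : ℕ) = 1 := by rw [← hqp, hsv]; simp [h0]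
  have mono_p : ∀ i j, σ i < σ j ↔ π (p.succAbove i) < π (p.succAbove j) := fun i j => by
    rw [hsv, hsv, Fin.succ_lt_succ_iff]
  have hsq : ∀ i, (π (q.succAbove i) : ℕ) = if (σ i : ℕ) = 0 then 0 else (σ i : ℕ) + 1 := by
    intro i
    by_cases hi : i = ⟨k - 1, hn⟩
    · subst hi
      rw [if_pos h0, Fin.succAbove_of_castSucc_lt _ _ (by simp [hq, Fin.lt_def]; omega)]
      change (π p : ℕ) = 0
      rw [hpv]; rfl
    · rw [if_neg]
      · rw [show q.succAbove i = p.succAbove i from ?_, hsv, Fin.val_succ]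
        have : (i : ℕ) ≠ k - 1 := fun h => hi (Fin.ext h)
        ext
        simp only [Fin.succAbove, hp, hq, Fin.lt_def, Fin.val_castSucc]
        split_ifs <;> first | rfl | omega
      · intro h
        exact hi (σ.injective (Fin.ext (by rw [h, h0])))
  have mono_q : ∀ i j, σ i < σ j ↔ π (q.succAbove i) < π (q.succAbove j) := fun i j => by
    rw [Fin.lt_def, Fin.lt_def, hsq, hsq]
    split_ifs <;> omega
  rw [avoids321Gon_iff k hk] at h ⊢
  constructor
  · rintro ⟨i, j, l, hij, hjl, h1, h2⟩
    apply h.1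
    have hi : i ≠ p := by rintro rfl; rw [hpv] at h2; simp at h2
    have hj : j ≠ p := by rintro rfl; rw [hpv] at h1; simp at h1
    by_cases hl : l = p
    · have hiq : i ≠ q := by
        rw [Fin.lt_def] at *
        rintro rfl
        omega
      have hjq : j ≠ q := by
        rintro rfl
        rw [hl, Fin.lt_def] at hjl
        simp [hp, hq] at hjl
        omega
      have hlq : l ≠ q := by
        rw [hl]
        intro h
        simp [hp, hq] at h
        omega
      obtain ⟨i, rfl⟩ := Fin.exists_succAbove_eq hiq
      obtain ⟨j, rfl⟩ := Fin.exists_succAbove_eq hjq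
      obtain ⟨l, rfl⟩ := Fin.exists_succAbove_eq hlq
      exact ⟨i, j, l, by simpa using hij, by simpa using hjl, (mono_q _ _).2 h1, (mono_q _ _).2 h2⟩
    · obtain ⟨i, rfl⟩ := Fin.exists_succAbove_eq hi
      obtain ⟨j, rfl⟩ := Fin.exists_succAbove_eq hj
      obtain ⟨l, rfl⟩ := Fin.exists_succAbove_eq hl
      exact ⟨i, j, l, by simpa using hij, by simpa using hjl, (mono_p _ _).2 h1, (mono_p _ _).2 h2⟩
  · rintro a sep ha ⟨f, hf, hu⟩
    apply h.2 a sep ha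
    by_cases hfp : ∀ x, f x ≠ p
    · exact HasOcc.of_range_subset (Fin.strictMono_succAbove p) mono_p hf hu
        fun x => Fin.exists_succAbove_eq (hfp x)
    by_cases hfq : ∀ x, f x ≠ q
    · exact HasOcc.of_range_subset (Fin.strictMono_succAbove q) mono_q hf hu
        fun x => Fin.exists_succAbove_eq (hfq x)
    exfalso
    push Not at hfp hfq
    obtain ⟨x, hx⟩ := hfp
    obtain ⟨y, hy⟩ := hfq
    have hx1 := gonEntry_eq_one_of_occ ha hk hu (x := x) (by rw [hx, hpv]; rfl)
    have hxle := hf.val_le_apply_fin x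
    rw [hx] at hxle
    simp only [hp] at hxle
    cases sep
    · simp at hx1; omega
    simp at hx1
    have hxy : x < y := by
      rw [← hf.lt_iff_lt, hx, hy, Fin.lt_def]
      simp only [hp, hq]; omega
    have hyle := hf.val_le_apply_fin y
    rw [hy] at hyle
    rw [Fin.lt_def] at hxy
    simp only [hq] at hyle
    have hyk : (y : ℕ) = k := by omega
    have hlt : π (f ⟨k + 1, by omega⟩) < π (f y) := by
      rw [← hu, hyk]
      simp [gonEntry]
      split_ifs <;> omega
    have hz : π (f ⟨k + 1, by omega⟩) = π (f x) := by
      ext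
      rw [hy, Fin.lt_def, hqv] at hlt
      rw [hx, hpv, Fin.val_zero]
      omega
    have := hf.injective (π.injective hz)
    rw [Fin.ext_iff] at this
    simp at this
    omega

/-- Avoidance is preserved when inserting the values `k - 1`, `k`, `0` (0-indexed) at positions
`0`, `1`, `k - 1` of a permutation, provided the first `k - 1` entries become increasing. -/
theorem Avoids321Gon.of_insert_three {m n k : ℕ} (hk : 3 ≤ k) (hm : 0 < m)
    {σ : Equiv.Perm (Fin m)} {π : Equiv.Perm (Fin n)} {g : Fin m → Fin n} (hg : StrictMono g)
    (h : ∀ i j, σ i < σ j ↔ π (g i) < π (g j))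
    (hr : ∀ i : Fin n, (i : ℕ) = 0 ∨ (i : ℕ) = 1 ∨ (i : ℕ) = k - 1 ∨ ∃ j, g j = i)
    (h0 : ∀ i : Fin n, (i : ℕ) = 0 → (π i : ℕ) = k - 1)
    (h1 : ∀ i : Fin n, (i : ℕ) = 1 → (π i : ℕ) = k)
    (hz : ∀ i : Fin n, (i : ℕ) = k - 1 → (π i : ℕ) = 0)
    (hinc : ∀ i j : Fin n, i < j → (j : ℕ) < k - 1 → π i < π j)
    (hg0 : k < (π (g ⟨0, hm⟩) : ℕ)) (ha : Avoids321Gon k σ) : Avoids321Gon k π := by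
  rw [avoids321Gon_iff k hk] at ha ⊢
  constructor
  · rintro ⟨i, j, l, hij, hjl, hlj, hji⟩
    apply ha.1
    have hi0 := h0 i
    have hi1 := h1 i
    have hiz := hz i
    have hj1 := h1 j
    have hjz := hz j
    have hinc' := hinc i j hij
    simp only [Fin.lt_def] at hij hjl hlj hji hinc'
    have hj' : ∃ j', g j' = j := by
      rcases hr j with hj | hj | hj | hj
      · omega
      · omega
      · omega
      · exact hj
    have hl' : ∃ l', g l' = l := by
      rcases hr l with hl | hl | hl | hl
      · omega
      · omega
      · omega
      · exact hl
    obtain ⟨j', rfl⟩ := hj'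
    obtain ⟨l', rfl⟩ := hl'
    have hi' : ((π i : ℕ) ≤ k) ∨ ∃ i', g i' = i := by
      rcases hr i with hi | hi | hi | hi
      · omega
      · omega
      · omega
      · exact Or.inr hi
    rcases hi' with hi' | ⟨i', rfl⟩
    · refine ⟨⟨0, hm⟩, j', l', ?_, hg.lt_iff_lt.1 hjl, (h _ _).2 hlj, (h _ _).2 ?_⟩
      · by_contra hcon
        have : j' = ⟨0, hm⟩ := by
          ext
          rw [Fin.lt_def] at hcon
          simp only at *
          omega
        subst this
        omega
      · rw [Fin.lt_def]; omega
    · exact ⟨i', j', l', hg.lt_iff_lt.1 hij, hg.lt_iff_lt.1 hjl, (h _ _).2 hlj, (h _ _).2 hji⟩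
  · rintro a sep has ⟨f, hf, hu⟩
    have k0 : 0 < 2 * k := by omega
    have k1 : 1 < 2 * k := by omega
    have f01 : f ⟨0, k0⟩ < f ⟨1, k1⟩ := hf (by simp [Fin.lt_def])
    rw [Fin.lt_def] at f01
    have entry0 : gonEntry k a sep 0 = a := by simp [gonEntry]
    have hnz : ∀ x, (f x : ℕ) ≠ k - 1 := by
      intro x hx
      have hx1 := gonEntry_eq_one_of_occ has hk hu (x := x) (hz _ hx)
      have hxle := hf.val_le_apply_fin x
      cases sep
      · simp at hx1; omega
      simp at hx1
      have hfix : ∀ d (y : Fin (2 * k)), (y : ℕ) + d = k - 1 → (f y : ℕ) + d ≤ k - 1 := by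
        intro d
        induction d with
        | zero =>
          intro y hy
          have : y = x := Fin.ext (by omega)
          rw [this, hx]; omega
        | succ d ih =>
          intro y hy
          have h1 := ih ⟨y + 1, by omega⟩ (by simp only; omega)
          have h2 : f y < f ⟨y + 1, by omega⟩ := hf (by simp [Fin.lt_def])
          rw [Fin.lt_def] at h2
          omega
      have e0 := h0 (f ⟨0, k0⟩) (by have := hfix (k - 1) ⟨0, k0⟩ (by simp); omega)
      have e1 := h1 (f ⟨1, k1⟩) (by have := hfix (k - 2) ⟨1, k1⟩ (by simp; omega); omega)
      rcases has with rfl | rfl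
      · have t1 := (hu ⟨0, k0⟩ ⟨2 * a - 1, by omega⟩).1 (by
          simp [gonEntry]
          split_ifs <;> omega)
        have t2 := (hu ⟨2 * a - 1, by omega⟩ ⟨1, k1⟩).1 (by
          simp [gonEntry]
          split_ifs <;> omega)
        rw [Fin.lt_def] at t1 t2
        omega
      · have := gonEntry_le_of_occ (Or.inr rfl) hk hu (c := 0) (fun _ => Nat.zero_le _) ⟨0, k0⟩
        simp only [entry0] at this
        omega
    by_cases hrange : ∀ x, ∃ i, g i = f x
    · exact ha.2 a sep has (HasOcc.of_range_subset hg h hf hu hrange)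
    push Not at hrange
    obtain ⟨x, hx⟩ := hrange
    have hpos : ∀ x, 1 ≤ (π (f x) : ℕ) := by
      intro x
      by_contra hcon
      apply hnz x
      have hkn : k - 1 < n := by
        have := hf.val_le_apply_fin ⟨2 * k - 1, by omega⟩
        simp only at this
        omega
      have : f x = ⟨k - 1, hkn⟩ := π.injective (Fin.ext (by rw [hz ⟨k - 1, hkn⟩ rfl]; omega))
      rw [this]
    have hge := gonEntry_le_of_occ has hk hu hpos
    have hge0 := hge ⟨0, k0⟩
    simp only [entry0] at hge0
    have f0 : (f ⟨0, k0⟩ : ℕ) ≠ 0 := by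
      intro h
      have := h0 _ h
      omega
    have f1 : (f ⟨0, k0⟩ : ℕ) ≠ 1 := by
      intro h
      have := h1 _ h
      obtain ⟨y, hy, hye⟩ := exists_gonEntry_eq sep has hk (r := k - 1) (by omega) (by omega)
      have t1 := hge ⟨y, hy⟩
      have t2 := (hu ⟨y, hy⟩ ⟨0, k0⟩).1 (by simp only [hye, entry0]; omega)
      rw [Fin.lt_def] at t2
      simp only [hye] at t1
      have hn0 : 0 < n := by have := (f ⟨y, hy⟩).2; omega
      have t3 : f ⟨y, hy⟩ = ⟨0, hn0⟩ := π.injective (Fin.ext (by rw [h0 ⟨0, hn0⟩ rfl]; omega))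
      have t4 := hf.monotone (show (⟨0, k0⟩ : Fin (2 * k)) ≤ ⟨y, hy⟩ by simp [Fin.le_def])
      rw [t3, Fin.le_def] at t4
      simp only at t4
      omega
    have fx := hf.monotone (show (⟨0, k0⟩ : Fin (2 * k)) ≤ x by simp [Fin.le_def])
    rw [Fin.le_def] at fx
    rcases hr (f x) with hc | hc | hc | ⟨j, hj⟩
    · omega
    · omega
    · exact hnz x hc
    · exact hx j hj

/-- If `π` starts with `k - 1` increasing large entries, then its minimum, then a new maximum so
far, and some value other than `π 0` between `k - 1` and `π 1` exists, then `π` contains a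
`k`-gon pattern. -/
theorem exists_gon_hasOcc {n k : ℕ} (hk : 3 ≤ k) (hn : k < n) {π : Equiv.Perm (Fin n)}
    (h321 : ¬ ∃ i j l, i < j ∧ j < l ∧ π l < π j ∧ π j < π i)
    (hs : StartsInc k (k - 1) π) (hz : (π ⟨k - 1, by omega⟩ : ℕ) = 0)
    (hmax : π ⟨k - 2, by omega⟩ < π ⟨k, hn⟩) (v : Fin n) (hv : k - 1 ≤ (v : ℕ))
    (hv1 : v < π ⟨1, by omega⟩) (hv0 : v ≠ π ⟨0, by omega⟩) :
    ∃ a sep, (a = k ∨ a = k + 1) ∧ HasOcc π (2 * k) (gonEntry k a sep) := by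
  have n1 : 1 < n := by omega
  have hmax' : ∀ i : Fin n, (i : ℕ) < k - 1 → (π i : ℕ) < π ⟨k, hn⟩ := by
    intro i hi
    by_cases hi' : (i : ℕ) = k - 2
    · rw [show i = ⟨k - 2, by omega⟩ from Fin.ext hi']
      exact hmax
    · exact (hs.1 i ⟨k - 2, by omega⟩ (by rw [Fin.lt_def]; simp only; omega)
        (by simp only; omega)).trans hmax
  have hone : ∀ i : Fin n, 1 ≤ (i : ℕ) → (i : ℕ) < k - 1 → (π ⟨1, n1⟩ : ℕ) ≤ π i := by
    intro i hi hik
    by_cases hi' : (i : ℕ) = 1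
    · rw [show i = ⟨1, n1⟩ from Fin.ext hi']
    · exact (hs.1 ⟨1, n1⟩ i (by rw [Fin.lt_def]; simp only; omega) hik).le
  have hv0' : (v : ℕ) ≠ π ⟨0, by omega⟩ := fun h => hv0 (Fin.ext h)
  have hv1' : (v : ℕ) < π ⟨1, n1⟩ := hv1
  have hpos : ∀ u : Fin n, 1 ≤ (u : ℕ) → ((u : ℕ) < k - 1 ∨ u = v) → k < (π.symm u : ℕ) := by
    intro u hu huv
    by_contra hcon
    obtain ⟨i, rfl⟩ := π.surjective u
    rw [Equiv.symm_apply_apply] at hcon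
    by_cases hi : (i : ℕ) = k
    · rw [show i = ⟨k, hn⟩ from Fin.ext hi] at huv
      have := hmax' ⟨1, n1⟩ (by simp only; omega)
      have := hs.2 ⟨1, n1⟩ (by simp only; omega)
      rcases huv with huv | huv
      · omega
      · rw [Fin.ext_iff] at huv; omega
    by_cases hi1 : (i : ℕ) = k - 1
    · rw [show i = ⟨k - 1, by omega⟩ from Fin.ext hi1] at hu
      omega
    have := hs.2 i (by omega)
    rcases huv with huv | huv
    · omega
    · by_cases hi0 : (i : ℕ) = 0
      · rw [show i = ⟨0, by omega⟩ from Fin.ext hi0] at huv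
        exact hv0 huv.symm
      · have := hone i (by omega) (by omega)
        rw [Fin.ext_iff] at huv; omega
  have hord : ∀ u u' : Fin n, 1 ≤ (u : ℕ) → (u : ℕ) < k - 1 → u < u' →
      ((u' : ℕ) < k - 1 ∨ u' = v) → (π.symm u : ℕ) < π.symm u' := by
    intro u u' hu huk huu huv
    rw [Fin.lt_def] at huu
    by_contra hcon
    have hne : π.symm u ≠ π.symm u' := fun h => by
      have := π.symm.injective h
      rw [Fin.ext_iff] at this
      omega
    have hne' : (π.symm u : ℕ) ≠ π.symm u' := fun h => hne (Fin.ext h)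
    have hp' := hpos u' (by omega) huv
    refine h321 ⟨⟨1, n1⟩, π.symm u', π.symm u, ?_, ?_, ?_, ?_⟩
    · rw [Fin.lt_def]; simp only; omega
    · rw [Fin.lt_def]; omega
    · simpa using huu
    · rw [Equiv.apply_symm_apply, Fin.lt_def]
      have := hs.2 ⟨1, n1⟩ (by simp only; omega)
      rcases huv with huv | rfl
      · omega
      · exact hv1
  let a := if v < π ⟨0, by omega⟩ then k + 1 else k
  have ha : a = k ∨ a = k + 1 := by
    simp only [a]
    split_ifs <;> simp
  have hav : (a = k + 1 ∧ (v : ℕ) < π ⟨0, by omega⟩) ∨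
      (a = k ∧ (π ⟨0, by omega⟩ : ℕ) < v) := by
    simp only [a]
    split_ifs with h
    · exact Or.inl ⟨rfl, h⟩
    · refine Or.inr ⟨rfl, ?_⟩
      rw [Fin.lt_def] at h
      omega
  let f : Fin (2 * k) → Fin n := fun x =>
    if (x : ℕ) ≤ k then ⟨min x k, by omega⟩
    else if (x : ℕ) < 2 * k - 1 then π.symm ⟨min (x - k) (k - 1), by omega⟩
    else π.symm v
  have f1 : ∀ x : Fin (2 * k), (x : ℕ) ≤ k → (f x : ℕ) = x := by
    intro x hx
    simp only [f, if_pos hx]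
    omega
  have f2 : ∀ x : Fin (2 * k), k < (x : ℕ) → k < (f x : ℕ) := by
    intro x hx
    simp only [f]
    rw [if_neg (by omega)]
    split_ifs with h
    · exact hpos _ (by simp only; omega) (Or.inl (by simp only; omega))
    · exact hpos _ (by omega) (Or.inr rfl)
  have f3 : ∀ x y : Fin (2 * k), k < (x : ℕ) → x < y → (f x : ℕ) < f y := by
    intro x y hx hxy
    rw [Fin.lt_def] at hxy
    have ex : f x = π.symm ⟨min (x - k) (k - 1), by omega⟩ := by
      simp only [f]
      rw [if_neg (by omega), if_pos (by omega)]
    rw [ex]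
    by_cases h : (y : ℕ) < 2 * k - 1
    · have ey : f y = π.symm ⟨min (y - k) (k - 1), by omega⟩ := by
        simp only [f]
        rw [if_neg (by omega), if_pos h]
      rw [ey]
      apply hord
      · simp only; omega
      · simp only; omega
      · rw [Fin.lt_def]; simp only; omega
      · left; simp only; omega
    · have ey : f y = π.symm v := by
        simp only [f]
        rw [if_neg (by omega), if_neg h]
      rw [ey]
      apply hord
      · simp only; omega
      · simp only; omega
      · rw [Fin.lt_def]; simp only; omega
      · right; rfl
  have hf : StrictMono f := by
    intro x y hxy
    have := f1 x
    have := f1 y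
    have := f2 x
    have := f2 y
    have := f3 x y
    rw [Fin.lt_def] at *
    omega
  have F0 : ∀ x : Fin (2 * k), (x : ℕ) = 0 → π (f x) = π ⟨0, by omega⟩ := fun x hx => by
    congr 1
    exact Fin.ext (by rw [f1 x (by omega)]; simp [hx])
  have Fz : ∀ x : Fin (2 * k), (x : ℕ) = k - 1 → (π (f x) : ℕ) = 0 := fun x hx => by
    rw [← hz]
    congr 2
    exact Fin.ext (by rw [f1 x (by omega)]; simp [hx])
  have Fk : ∀ x : Fin (2 * k), (x : ℕ) = k → π (f x) = π ⟨k, hn⟩ := fun x hx => by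
    congr 1
    exact Fin.ext (by rw [f1 x (by omega)]; simp [hx])
  have Fs : ∀ x : Fin (2 * k), k < (x : ℕ) → (x : ℕ) < 2 * k - 1 → (π (f x) : ℕ) = x - k :=
    fun x hx hx' => by
      simp only [f]
      rw [if_neg (by omega), if_pos hx', Equiv.apply_symm_apply]
      simp only
      omega
  have Fv : ∀ x : Fin (2 * k), (x : ℕ) = 2 * k - 1 → (π (f x) : ℕ) = v := fun x hx => by
    simp only [f]
    rw [if_neg (by omega), if_neg (by omega), Equiv.apply_symm_apply]
  have Fmono : ∀ x y : Fin (2 * k), (x : ℕ) < y → (y : ℕ) < k - 1 → (π (f x) : ℕ) < π (f y) :=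
    fun x y hxy hy => hs.1 _ _ (hf hxy) (by rw [f1 y (by omega)]; exact hy)
  have Fmax : ∀ x : Fin (2 * k), (x : ℕ) < k - 1 → (π (f x) : ℕ) < π ⟨k, hn⟩ :=
    fun x hx => hmax' _ (by rw [f1 x (by omega)]; exact hx)
  have Fone : ∀ x : Fin (2 * k), 1 ≤ (x : ℕ) → (x : ℕ) < k - 1 →
      (π ⟨1, n1⟩ : ℕ) ≤ π (f x) :=
    fun x hx hx' => hone _ (by rw [f1 x (by omega)]; exact hx) (by rw [f1 x (by omega)]; exact hx')
  have p0 := hs.2 ⟨0, by omega⟩ (by simp only; omega)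
  have p01 : (π ⟨0, by omega⟩ : ℕ) < π ⟨1, n1⟩ :=
    hs.1 _ _ (by simp [Fin.lt_def]) (by simp only; omega)
  have p1k := hmax' ⟨1, n1⟩ (by simp only; omega)
  have entry : ∀ x : Fin (2 * k),
      ((x : ℕ) = 0 ∧ gonEntry k a true x = a ∧ (π (f x) : ℕ) = π ⟨0, by omega⟩) ∨
      ((1 ≤ (x : ℕ) ∧ (x : ℕ) < k - 1) ∧ gonEntry k a true x = k + 1 + x ∧
        (π ⟨1, n1⟩ : ℕ) ≤ π (f x) ∧ (π (f x) : ℕ) < π ⟨k, hn⟩) ∨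
      ((x : ℕ) = k - 1 ∧ gonEntry k a true x = 1 ∧ (π (f x) : ℕ) = 0) ∨
      ((x : ℕ) = k ∧ gonEntry k a true x = 2 * k ∧ (π (f x) : ℕ) = π ⟨k, hn⟩) ∨
      ((k < (x : ℕ) ∧ (x : ℕ) < 2 * k - 1) ∧ gonEntry k a true x = x + 1 - k ∧
        (π (f x) : ℕ) = x - k) ∨
      ((x : ℕ) = 2 * k - 1 ∧ gonEntry k a true x = 2 * k + 1 - a ∧ (π (f x) : ℕ) = v) := by
    intro x
    have hx := x.2
    have hc : (x : ℕ) = 0 ∨ (1 ≤ (x : ℕ) ∧ (x : ℕ) < k - 1) ∨ (x : ℕ) = k - 1 ∨ (x : ℕ) = k ∨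
        (k < (x : ℕ) ∧ (x : ℕ) < 2 * k - 1) ∨ (x : ℕ) = 2 * k - 1 := by omega
    rcases hc with h | h | h | h | h | h
    · exact Or.inl ⟨h, by simp [gonEntry, h], by rw [F0 x h]⟩
    · refine Or.inr (Or.inl ⟨h, ?_, Fone x h.1 h.2, Fmax x h.2⟩)
      rw [gonEntry, if_neg (by omega), if_pos (by omega)]
    · refine Or.inr (Or.inr (Or.inl ⟨h, ?_, Fz x h⟩))
      rw [gonEntry, if_neg (by omega), if_neg (by omega), if_neg (by omega), if_pos (by omega)]
      rfl
    · refine Or.inr (Or.inr (Or.inr (Or.inl ⟨h, ?_, by rw [Fk x h]⟩)))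
      rw [gonEntry, if_neg (by omega), if_neg (by omega), if_neg (by omega), if_neg (by omega),
        if_pos ⟨h, rfl⟩]
    · refine Or.inr (Or.inr (Or.inr (Or.inr (Or.inl ⟨h, ?_, Fs x h.1 h.2⟩))))
      rw [gonEntry, if_neg (by omega), if_neg (by omega), if_neg (by omega), if_neg (by omega),
        if_neg (by omega)]
    · refine Or.inr (Or.inr (Or.inr (Or.inr (Or.inr ⟨h, ?_, Fv x h⟩))))
      rw [gonEntry, if_neg (by omega), if_neg (by omega), if_pos (by omega)]
  have key : ∀ x y : Fin (2 * k), gonEntry k a true x < gonEntry k a true y →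
      π (f x) < π (f y) := by
    intro x y hxy
    rw [Fin.lt_def]
    have hmono := Fmono x y
    have ex := entry x
    have ey := entry y
    clear_value a f
    clear F0 Fz Fk Fs Fv Fmono Fmax Fone f1 f2 f3 hord hpos hone hmax' hs h321 entry
    rcases ex with ⟨h, e, e'⟩ | ⟨h, e, e'⟩ | ⟨h, e, e'⟩ | ⟨h, e, e'⟩ | ⟨h, e, e'⟩ | ⟨h, e, e'⟩ <;>
    rcases ey with ⟨g, d, d'⟩ | ⟨g, d, d'⟩ | ⟨g, d, d'⟩ | ⟨g, d, d'⟩ | ⟨g, d, d'⟩ | ⟨g, d, d'⟩ <;>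
    rw [e, d] at hxy <;> omega
  refine ⟨a, true, ha, f, hf, fun x y => ⟨key x y, fun h => ?_⟩⟩
  by_contra hcon
  rcases Nat.lt_or_ge (gonEntry k a true y) (gonEntry k a true x) with h' | h'
  · exact lt_asymm h (key y x h')
  · have : x = y := Fin.ext (gonEntry_injOn true ha hk x.2 y.2 (by omega))
    rw [this] at h
    exact lt_irrefl _ h

/-- In a `321`-`k`-gon-avoiding permutation starting with `k - 1` increasing entries `≥ k`
followed by `1`, either `2` comes next, or the first two entries are `k`, `k + 1` and the next
entry exceeds all previous ones. -/
theorem Avoids321Gon.start_eq {n k : ℕ} (hk : 3 ≤ k) (hn : k < n) {π : Equiv.Perm (Fin n)}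
    (ha : Avoids321Gon k π) (hs : StartsInc k (k - 1) π)
    (hz : (π ⟨k - 1, by omega⟩ : ℕ) = 0) (h1 : (π ⟨k, hn⟩ : ℕ) ≠ 1) :
    (π ⟨0, by omega⟩ : ℕ) = k - 1 ∧ (π ⟨1, by omega⟩ : ℕ) = k ∧
      π ⟨k - 2, by omega⟩ < π ⟨k, hn⟩ := by
  rw [avoids321Gon_iff k hk] at ha
  have hk2 := hs.2 ⟨k - 2, by omega⟩ (by simp only; omega)
  have hkne : ∀ i : Fin n, (i : ℕ) ≠ k → (π i : ℕ) ≠ π ⟨k, hn⟩ := fun i hi h =>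
    hi (by rw [π.injective (Fin.ext h)])
  have hmax : π ⟨k - 2, by omega⟩ < π ⟨k, hn⟩ := by
    by_contra hcon
    apply ha.1
    obtain ⟨l, hl⟩ := π.surjective ⟨1, by omega⟩
    have hl1 : (π l : ℕ) = 1 := by rw [hl]
    have t1 := hkne ⟨k - 1, by omega⟩ (by simp only; omega)
    have t2 := hkne ⟨k - 2, by omega⟩ (by simp only; omega)
    refine ⟨⟨k - 2, by omega⟩, ⟨k, hn⟩, l, ?_, ?_, ?_, ?_⟩
    · rw [Fin.lt_def]; simp only; omega
    · rw [Fin.lt_def]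
      by_contra hlk
      simp only at hlk
      have hlk' : (l : ℕ) ≠ k := fun h => h1 (by rw [← hl1]; congr 2; exact Fin.ext h.symm)
      have hlk1 : (l : ℕ) ≠ k - 1 := fun h => by
        have : (π l : ℕ) = 0 := by rw [← hz]; congr 2; exact Fin.ext h
        omega
      have := hs.2 l (by omega)
      omega
    · rw [Fin.lt_def]; omega
    · rw [Fin.lt_def] at *; omega
  have hno : ∀ v : Fin n, k - 1 ≤ (v : ℕ) → v < π ⟨1, by omega⟩ → v = π ⟨0, by omega⟩ := by
    intro v hv hv1
    by_contra hv0
    obtain ⟨a, sep, has, hocc⟩ := exists_gon_hasOcc hk hn ha.1 hs hz hmax v hv hv1 hv0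
    exact ha.2 a sep has hocc
  have h01 := hs.1 ⟨0, by omega⟩ ⟨1, by omega⟩ (by simp [Fin.lt_def]) (by simp only; omega)
  have hp0 := hs.2 ⟨0, by omega⟩ (by simp only; omega)
  rw [Fin.lt_def] at h01
  have e0 := hno ⟨k - 1, by omega⟩ (by simp) (by rw [Fin.lt_def]; simp only; omega)
  rw [Fin.ext_iff] at e0
  simp only at e0
  refine ⟨e0.symm, ?_, hmax⟩
  by_contra hne
  have e1 := hno ⟨k, by omega⟩ (by simp) (by rw [Fin.lt_def]; simp only; omega)
  rw [Fin.ext_iff] at e1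
  simp only at e1
  omega

theorem Nat.card_subtype_eq_of_injective {α β : Type*} {P : α → Prop} {Q : β → Prop} (e : α → β)
    (he : Function.Injective e) (hPQ : ∀ a, P a ↔ Q (e a)) (hQ : ∀ b, Q b → ∃ a, e a = b) :
    Nat.card {a // P a} = Nat.card {b // Q b} := by
  refine Nat.card_congr (Equiv.ofBijective (fun a => ⟨e a.1, (hPQ a.1).1 a.2⟩) ⟨?_, ?_⟩)
  · intro a b hab
    exact Subtype.ext (he (congrArg Subtype.val hab))
  · rintro ⟨b, hb⟩
    obtain ⟨a, rfl⟩ := hQ b hb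
    exact ⟨⟨a, (hPQ a).2 hb⟩, rfl⟩

theorem Nat.card_subtype_and_add_not {α : Type*} [Finite α] (P R : α → Prop) :
    Nat.card {a // P a} = Nat.card {a // P a ∧ R a} + Nat.card {a // P a ∧ ¬ R a} := by
  classical
  have := Fintype.ofFinite α
  simp only [Nat.card_eq_fintype_card, Fintype.card_subtype]
  rw [← Finset.filter_filter, ← Finset.filter_filter, Finset.card_filter_add_card_filter_not]

theorem Fin.val_succAbove_eq_ite {n : ℕ} (p : Fin (n + 1)) (i : Fin n) :
    (p.succAbove i : ℕ) = if (i : ℕ) < p then (i : ℕ) else i + 1 := by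
  rw [Fin.succAbove]
  split_ifs <;> first | rfl | simp_all [Fin.lt_def]

theorem insertPerm_eq_of_val {n : ℕ} (p q : Fin (n + 1)) (σ : Equiv.Perm (Fin n))
    {i : Fin (n + 1)} {j : Fin n} (hij : (i : ℕ) = if (j : ℕ) < p then (j : ℕ) else j + 1) :
    (insertPerm p q σ i : ℕ) = if (σ j : ℕ) < q then (σ j : ℕ) else σ j + 1 := by
  rw [show i = p.succAbove j from Fin.ext (by rw [hij, Fin.val_succAbove_eq_ite]),
    insertPerm_succAbove, Fin.val_succAbove_eq_ite]

/-- Permutations in which the minimum `1` at position `k` is followed by `2` correspond to those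
with one entry less. -/
theorem card_followed_by_two {m k : ℕ} (hk : 3 ≤ k) (hm : k < m + 3) :
    Nat.card {σ : Equiv.Perm (Fin (m + 2)) //
      (Avoids321Gon k σ ∧ (σ ⟨k - 1, by omega⟩ : ℕ) = 0) ∧ StartsInc (k - 1) (k - 1) σ} =
    Nat.card {π : Equiv.Perm (Fin (m + 3)) //
      ((Avoids321Gon k π ∧ (π ⟨k - 1, by omega⟩ : ℕ) = 0) ∧ StartsInc k (k - 1) π) ∧
        (π ⟨k, hm⟩ : ℕ) = 1} := by
  refine Nat.card_subtype_eq_of_injective (insertPerm ⟨k - 1, by omega⟩ 0)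
    (insertPerm_injective _ _) (fun σ => ?_) ?_
  · have hlt : ∀ (i : Fin (m + 3)) (hi : (i : ℕ) < k - 1),
        (insertPerm ⟨k - 1, by omega⟩ 0 σ i : ℕ) = σ ⟨i, by omega⟩ + 1 := fun i hi => by
      rw [insertPerm_eq_of_val (j := ⟨i, by omega⟩)]
      · simp
      · simp [hi]
    have hk1 : (insertPerm ⟨k - 1, by omega⟩ 0 σ ⟨k, hm⟩ : ℕ) = σ ⟨k - 1, by omega⟩ + 1 := by
      rw [insertPerm_eq_of_val (j := ⟨k - 1, by omega⟩)]
      · simp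
      · simp; omega
    have hs : StartsInc (k - 1) (k - 1) σ ↔
        StartsInc k (k - 1) (insertPerm ⟨k - 1, by omega⟩ 0 σ) := by
      constructor
      · intro h
        refine ⟨fun i j hij hj => ?_, fun i hi => ?_⟩
        · have := h.1 ⟨i, by omega⟩ ⟨j, by omega⟩ hij hj
          rw [Fin.lt_def] at this ⊢
          rw [hlt i (by omega), hlt j hj]
          omega
        · have := h.2 ⟨i, by omega⟩ hi
          rw [hlt i hi]
          omega
      · intro h
        refine ⟨fun i j hij hj => ?_, fun i hi => ?_⟩
        · have := h.1 i.castSucc j.castSucc hij hj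
          rw [Fin.lt_def, hlt _ (by simp; omega), hlt _ (by simpa using hj)] at this
          rw [Fin.lt_def]
          simpa using this
        · have := h.2 i.castSucc hi
          rw [hlt _ (by simpa using hi)] at this
          simp at this
          omega
    constructor
    · rintro ⟨⟨ha, h0⟩, h⟩
      refine ⟨⟨⟨ha.insertPerm_zero hk (by omega) h0, ?_⟩, hs.1 h⟩, by rw [hk1, h0]⟩
      rw [insertPerm_same]; rfl
    · rintro ⟨⟨⟨ha, h0⟩, h⟩, h1⟩
      refine ⟨⟨ha.of_map hk (g := Fin.succAbove ⟨k - 1, by omega⟩) (Fin.strictMono_succAbove _) ?_,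
        by omega⟩, hs.2 h⟩
      intro i j
      rw [insertPerm_succAbove, insertPerm_succAbove, Fin.succAbove_lt_succAbove_iff]
  · rintro π ⟨⟨⟨-, h0⟩, -⟩, -⟩
    exact exists_insertPerm_eq (Fin.ext h0)

/-- The permutation obtained from `σ` by inserting the values `k - 1`, `k`, `0` at positions
`0`, `1`, `k - 1` (0-indexed). -/
def insertThree {m k : ℕ} (hm : k < m + 3) (σ : Equiv.Perm (Fin m)) :
    Equiv.Perm (Fin (m + 3)) :=
  insertPerm ⟨k - 1, by omega⟩ 0
    (insertPerm 0 ⟨k - 2, by omega⟩ (insertPerm 0 ⟨k - 2, by omega⟩ σ))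

theorem insertThree_injective {m k : ℕ} (hm : k < m + 3) :
    Function.Injective (insertThree hm) :=
  (insertPerm_injective _ _).comp ((insertPerm_injective _ _).comp (insertPerm_injective _ _))

theorem insertThree_of_val {m k : ℕ} (hm : k < m + 3) (σ : Equiv.Perm (Fin m))
    {i : Fin (m + 3)} {j : Fin m}
    (hij : (i : ℕ) = if (j : ℕ) + 2 < k - 1 then (j : ℕ) + 2 else j + 3) :
    (insertThree hm σ i : ℕ) = if (σ j : ℕ) < k - 2 then (σ j : ℕ) + 1 else σ j + 3 := by
  rw [insertThree, insertPerm_eq_of_val (j := j.succ.succ),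
    insertPerm_eq_of_val (i := j.succ.succ) (j := j.succ),
    insertPerm_eq_of_val (i := j.succ) (j := j)]
  · simp
    split_ifs <;> omega
  · simp
  · simp
  · simpa using hij

theorem insertThree_zero {m k : ℕ} (hk : 3 ≤ k) (hm : k < m + 3) (σ : Equiv.Perm (Fin m)) :
    (insertThree hm σ 0 : ℕ) = k - 1 := by
  rw [insertThree, insertPerm_eq_of_val (j := 0), insertPerm_same]
  · simp; omega
  · simp; omega

theorem insertThree_one {m k : ℕ} (hk : 3 ≤ k) (hm : k < m + 3) (σ : Equiv.Perm (Fin m)) :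
    (insertThree hm σ 1 : ℕ) = k := by
  rw [insertThree, insertPerm_eq_of_val (j := 1),
    insertPerm_eq_of_val (i := 1) (j := 0), insertPerm_same]
  · simp; omega
  · simp
  · simp; omega

theorem insertThree_pred {m k : ℕ} (hm : k < m + 3) (σ : Equiv.Perm (Fin m)) :
    (insertThree hm σ ⟨k - 1, by omega⟩ : ℕ) = 0 := by
  rw [insertThree, insertPerm_same]; rfl

theorem exists_insertThree_eq {m k : ℕ} (hk : 3 ≤ k) (hm : k < m + 3)
    {π : Equiv.Perm (Fin (m + 3))} (h0 : (π 0 : ℕ) = k - 1) (h1 : (π 1 : ℕ) = k)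
    (hz : (π ⟨k - 1, by omega⟩ : ℕ) = 0) : ∃ σ, insertThree hm σ = π := by
  have hk1 : k - 1 < m + 3 := by omega
  have hk2 : k - 2 < m + 2 := by omega
  have hk2' : k - 2 < m + 1 := by omega
  obtain ⟨τ, rfl⟩ := exists_insertPerm_eq (p := ⟨k - 1, hk1⟩) (q := 0) (π := π) (Fin.ext hz)
  rw [insertPerm_eq_of_val (j := 0) _ _ _ (by simp; omega)] at h0
  rw [insertPerm_eq_of_val (j := 1) _ _ _ (by simp; omega)] at h1
  simp at h0 h1
  obtain ⟨ρ, rfl⟩ := exists_insertPerm_eq (p := 0) (q := ⟨k - 2, hk2⟩) (π := τ)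
    (Fin.ext (by simp only; omega))
  rw [insertPerm_eq_of_val (j := 0) _ _ _ (by simp)] at h1
  obtain ⟨σ, rfl⟩ := exists_insertPerm_eq (p := 0) (q := ⟨k - 2, hk2'⟩) (π := ρ)
    (Fin.ext (by simp only at h1 ⊢; split_ifs at h1 <;> omega))
  exact ⟨σ, rfl⟩

/-- Permutations in which the minimum `1` at position `k` is not followed by `2` correspond to
those with three entries less. -/
theorem card_not_followed_by_two {m k : ℕ} (hk : 3 ≤ k) (hm : k < m + 3) :
    Nat.card {σ : Equiv.Perm (Fin m) // Avoids321Gon k σ ∧ StartsInc (k - 1) (k - 2) σ} =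
    Nat.card {π : Equiv.Perm (Fin (m + 3)) //
      ((Avoids321Gon k π ∧ (π ⟨k - 1, by omega⟩ : ℕ) = 0) ∧ StartsInc k (k - 1) π) ∧
        ¬ (π ⟨k, hm⟩ : ℕ) = 1} := by
  refine Nat.card_subtype_eq_of_injective (insertThree hm) (insertThree_injective hm)
    (fun σ => ?_) ?_
  · set π := insertThree hm σ with hπ
    let g : Fin m → Fin (m + 3) := fun j =>
      ⟨if (j : ℕ) + 2 < k - 1 then j + 2 else j + 3, by split_ifs <;> omega⟩
    have gval : ∀ j, (g j : ℕ) = if (j : ℕ) + 2 < k - 1 then (j : ℕ) + 2 else j + 3 := fun j => rfl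
    have πg : ∀ j, (π (g j) : ℕ) = if (σ j : ℕ) < k - 2 then (σ j : ℕ) + 1 else σ j + 3 :=
      fun j => insertThree_of_val hm σ (gval j)
    have hg : StrictMono g := fun i j hij => by
      rw [Fin.lt_def] at hij ⊢
      rw [gval, gval]
      split_ifs <;> omega
    have hord : ∀ i j, σ i < σ j ↔ π (g i) < π (g j) := fun i j => by
      rw [Fin.lt_def, Fin.lt_def, πg, πg]
      split_ifs <;> omega
    have h0 : ∀ i : Fin (m + 3), (i : ℕ) = 0 → (π i : ℕ) = k - 1 := fun i hi => by
      rw [show i = 0 from Fin.ext hi]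
      exact insertThree_zero hk hm σ
    have h1 : ∀ i : Fin (m + 3), (i : ℕ) = 1 → (π i : ℕ) = k := fun i hi => by
      rw [show i = 1 from Fin.ext hi]
      exact insertThree_one hk hm σ
    have hz : ∀ i : Fin (m + 3), (i : ℕ) = k - 1 → (π i : ℕ) = 0 := fun i hi => by
      rw [show i = ⟨k - 1, by omega⟩ from Fin.ext hi]
      exact insertThree_pred hm σ
    have hr : ∀ i : Fin (m + 3),
        (i : ℕ) = 0 ∨ (i : ℕ) = 1 ∨ (i : ℕ) = k - 1 ∨ ∃ j, g j = i := by
      intro i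
      by_cases hi : (i : ℕ) = 0 ∨ (i : ℕ) = 1 ∨ (i : ℕ) = k - 1
      · tauto
      · refine Or.inr (Or.inr (Or.inr ⟨⟨if (i : ℕ) < k - 1 then i - 2 else i - 3, ?_⟩, ?_⟩))
        · split_ifs <;> omega
        · ext
          rw [gval]
          simp only
          split_ifs <;> omega
    have hgk : g ⟨k - 3, by omega⟩ = ⟨k, hm⟩ := Fin.ext (by
      rw [gval]
      simp only
      split_ifs <;> omega)
    constructor
    · rintro ⟨ha, hs⟩
      have big : ∀ j : Fin m, (j : ℕ) < k - 2 → k < (π (g j) : ℕ) := fun j hj => by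
        have := hs.2 j hj
        rw [πg]
        split_ifs <;> omega
      have hs' : StartsInc k (k - 1) π := by
        refine ⟨fun i j hij hj => ?_, fun i hi => ?_⟩
        · rw [Fin.lt_def] at hij
          rcases hr j with hj' | hj' | hj' | ⟨j, rfl⟩
          · omega
          · rw [Fin.lt_def, h0 i (by omega), h1 j hj']; omega
          · omega
          have hj2 : (j : ℕ) < k - 3 := by
            rw [gval] at hj
            split_ifs at hj <;> omega
          rcases hr i with hi' | hi' | hi' | ⟨i, rfl⟩
          · have := big j (by omega)
            rw [Fin.lt_def, h0 i hi']; omega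
          · have := big j (by omega)
            rw [Fin.lt_def, h1 i hi']; omega
          · omega
          · rw [← hord]
            exact hs.1 i j (hg.lt_iff_lt.1 hij) (by omega)
        · rcases hr i with hi' | hi' | hi' | ⟨i, rfl⟩
          · rw [h0 i hi']; omega
          · rw [h1 i hi']; omega
          · omega
          · have := big i (by
              rw [gval] at hi
              split_ifs at hi <;> omega)
            omega
      refine ⟨⟨⟨?_, hz _ rfl⟩, hs'⟩, ?_⟩
      · exact ha.of_insert_three hk (by omega) hg hord hr h0 h1 hz hs'.1
          (big _ (by simp only; omega))
      · have := big ⟨k - 3, by omega⟩ (by simp only; omega)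
        rw [hgk] at this
        omega
    · rintro ⟨⟨⟨ha, hz'⟩, hs⟩, hne⟩
      obtain ⟨-, -, hmax⟩ := ha.start_eq hk hm hs hz' hne
      have hmono : ∀ i j : Fin (m + 3), i < j → (i : ℕ) ≠ k - 1 →
          (j : ℕ) < k - 1 ∨ (j : ℕ) = k → π i < π j := by
        intro i j hij hi hj
        rcases hj with hj | hj
        · exact hs.1 i j hij hj
        · rw [show j = ⟨k, hm⟩ from Fin.ext hj] at hij ⊢
          rw [Fin.lt_def] at hij
          simp only at hij
          by_cases hi' : (i : ℕ) = k - 2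
          · rw [show i = ⟨k - 2, by omega⟩ from Fin.ext hi']
            exact hmax
          · refine (hs.1 i ⟨k - 2, by omega⟩ ?_ (by simp only; omega)).trans hmax
            rw [Fin.lt_def]; simp only; omega
      have gsmall : ∀ j : Fin m, (j : ℕ) < k - 2 → (g j : ℕ) < k - 1 ∨ (g j : ℕ) = k :=
        fun j hj => by
          rw [gval]
          split_ifs <;> omega
      refine ⟨ha.of_map hk hg hord, fun i j hij hj => ?_, fun i hi => ?_⟩
      · rw [hord]
        refine hmono _ _ (hg hij) ?_ (gsmall j hj)
        rw [gval]
        split_ifs <;> omega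
      · have h := hmono 1 (g i) (by
          rw [Fin.lt_def, gval]
          simp only [Fin.val_one]
          split_ifs <;> omega) (by simp; omega) (gsmall i hi)
        rw [Fin.lt_def, h1 1 (by simp), πg] at h
        split_ifs at h <;> omega
  · rintro π ⟨⟨⟨ha, hz⟩, hs⟩, hne⟩
    obtain ⟨h0, h1, -⟩ := ha.start_eq hk hm hs hz hne
    exact exists_insertThree_eq hk hm h0 h1 hz

/-- For `k ≥ 3` and `n ≥ k−1`: `C_k(n, k−1) = C_{k−1}(n−1, k−1) + A_{k−1}(n−3, k−2)`. -/
theorem Cseq_rec_a (k n : ℕ) (hk : 3 ≤ k) (hn : k - 1 ≤ n) :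
    Cseq k k n (k-1) = Cseq k (k-1) (n-1) (k-1) + Aseq k (k-1) (n-3) (k-2) := by
  by_cases hnk : n ≤ k
  · have zero : ∀ d n' m, n' + 1 - d < m → (Finset.Icc d n').powersetCard m = ∅ :=
      fun d n' m h => Finset.powersetCard_eq_empty.2 (by rwa [Nat.card_Icc])
    rw [Cseq, Cseq, Aseq, zero _ _ _ (by omega), zero _ _ _ (by omega), zero _ _ _ (by omega)]
    rfl
  · obtain ⟨m, rfl⟩ : ∃ m, n = m + 3 := ⟨n - 3, by omega⟩
    have hm : k < m + 3 := by omega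
    rw [show m + 3 - 1 = m + 2 from rfl, show m + 3 - 3 = m from rfl,
      Cseq_eq_card (show k - 1 < m + 3 by omega), Cseq_eq_card (show k - 1 < m + 2 by omega),
      Aseq_eq_card (by omega), card_followed_by_two hk hm, card_not_followed_by_two hk hm]
    exact Nat.card_subtype_and_add_not _ _
end

section
/- Let k ≥ 3 and n ≥ k−1. Then A_k(n, k) = B_k(n−1, k−2); that is, the number of 321-k-gon-avoiding permutations of {1,…,n} whose first k entries are increasing and all at least k equals the number of 321-k-gon-avoiding permutations of {1,…,n−1} whose first entry is k and whose next k−2 entries are increasing and all at least k+1. -/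
theorem containsPattern_of_pairwise {n : ℕ} (π : Equiv.Perm (Fin n)) (w : List ℕ)
    (V : ℕ → Fin n) (hV : ∀ u ∈ w, ∀ v ∈ w, u < v → V u < V v)
    (hw : w.Pairwise fun u v => π.symm (V u) < π.symm (V v)) : ContainsPattern π w := by
  refine ⟨fun a => π.symm (V (w.get a)), fun a b hab => List.pairwise_iff_get.1 hw a b hab,
    fun a b => ?_⟩
  simp only [Equiv.apply_symm_apply]
  refine ⟨hV _ (List.get_mem _ _) _ (List.get_mem _ _), fun h => ?_⟩
  by_contra hba
  rcases (not_lt.1 hba).eq_or_lt with he | hlt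
  · rw [he] at h
    exact lt_irrefl _ h
  · exact lt_asymm h (hV _ (List.get_mem _ _) _ (List.get_mem _ _) hlt)

theorem containsPattern_three_two_one {n : ℕ} (π : Equiv.Perm (Fin n)) {x y z : Fin n}
    (hxy : x < y) (hyz : y < z) (h₁ : π y < π x) (h₂ : π z < π y) :
    ContainsPattern π [3, 2, 1] := by
  refine ⟨![x, y, z], ?_, ?_⟩
  · rw [Fin.strictMono_iff_lt_succ]
    intro i
    fin_cases i <;> simpa
  · intro a b
    have h₃ := h₂.trans h₁
    fin_cases a <;> fin_cases b <;> simp [h₁, h₂, h₃, h₁.le, h₂.le, h₃.le]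

theorem containsPattern_gonPattern {k n a : ℕ} (hk : 3 ≤ k) (hkn : k + 1 < n)
    (π : Equiv.Perm (Fin n)) (h321 : AvoidsPattern π [3, 2, 1])
    (hmono : ∀ i j (_ : i < j) (hj : j < k), π ⟨i, by omega⟩ < π ⟨j, by omega⟩)
    (h0 : a = k ∧ (π ⟨0, by omega⟩ : ℕ) = k - 1 ∨ a = k + 1 ∧ k ≤ (π ⟨0, by omega⟩ : ℕ))
    (h1 : k + 1 ≤ (π ⟨1, by omega⟩ : ℕ)) :
    ContainsPattern π (gonPattern k a false) := by
  have hbig : ∀ i (hi : 1 ≤ i) (hik : i < k), k + 1 ≤ (π ⟨i, by omega⟩ : ℕ) := by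
    intro i hi hik
    rcases hi.eq_or_lt with rfl | hi
    · exact h1
    · exact h1.trans (hmono 1 i hi hik).le
  set V : ℕ → Fin n := fun v =>
    if v = a then π ⟨0, by omega⟩ else if v ≤ k + 1 then ⟨min (v - 1) k, by omega⟩
      else π ⟨min (v - k - 1) (k - 1), by omega⟩ with hVdef
  have hVa : V a = π ⟨0, by omega⟩ := by simp [hVdef]
  have hVlow : ∀ v, v ≤ k + 1 → v ≠ a → (V v : ℕ) = v - 1 := by
    intro v hv hva
    simp only [hVdef, hva, hv, if_true, if_false]
    omega
  have hVhigh : ∀ v (_ : k + 2 ≤ v) (hv' : v ≤ 2 * k), V v = π ⟨v - k - 1, by omega⟩ := by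
    intro v hv hv'
    have h1 : v ≠ a := by omega
    have h2 : ¬ v ≤ k + 1 := by omega
    simp only [hVdef, h1, h2, if_false]
    congr 2
    omega
  have hlowpos : ∀ v, 1 ≤ v → v ≤ k + 1 → v ≠ a → k ≤ (π.symm (V v) : ℕ) := by
    intro v hv1 hv hva
    by_contra hlt
    have hval := hVlow v hv hva
    have happ : π (π.symm (V v)) = V v := π.apply_symm_apply _
    generalize π.symm (V v) = p at hlt happ
    rcases Nat.eq_zero_or_pos (p : ℕ) with hp | hp
    · have hp0 : (⟨0, by omega⟩ : Fin n) = p := Fin.ext hp.symm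
      rw [hp0, happ] at h0
      omega
    · have := hbig p hp (by omega)
      rw [Fin.eta, happ] at this
      omega
  have hlowmono : ∀ u v, 1 ≤ u → u < v → v ≤ k + 1 → u ≠ a → v ≠ a →
      π.symm (V u) < π.symm (V v) := by
    intro u v hu huv hv hua hva
    by_contra hlt
    have hvu := hVlow u (by omega) hua
    have hvv := hVlow v hv hva
    have hne : π.symm (V v) ≠ π.symm (V u) := by
      intro h
      have := congrArg Fin.val (π.symm.injective h)
      omega
    have hpv := hlowpos v (by omega) hv hva
    refine h321 (containsPattern_three_two_one π (x := ⟨1, by omega⟩) (y := π.symm (V v))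
      (z := π.symm (V u)) ?_ (lt_of_le_of_ne (not_lt.1 hlt) hne) ?_ ?_)
    · rw [Fin.lt_def]
      simp only
      omega
    · rw [π.apply_symm_apply, Fin.lt_def]
      omega
    · rw [π.apply_symm_apply, π.apply_symm_apply, Fin.lt_def]
      omega
  have hmem : ∀ v ∈ gonPattern k a false, 1 ≤ v ∧ v ≤ 2 * k := by
    intro v hv
    simp [gonPattern, List.mem_range'_1] at hv
    omega
  apply containsPattern_of_pairwise π _ V
  · intro u hu v hv huv
    obtain ⟨hu1, hu2⟩ := hmem u hu
    obtain ⟨hv1, hv2⟩ := hmem v hv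
    rw [Fin.lt_def]
    rcases le_or_gt v (k + 1) with hvk | hvk
    · by_cases hva : v = a
      · have := hVlow u (by omega) (by omega)
        rw [hva, hVa]
        omega
      · have hvv := hVlow v hvk hva
        by_cases hua : u = a
        · rw [hua, hVa]
          omega
        · have := hVlow u (by omega) hua
          omega
    · have hb := hbig (v - k - 1) (by omega) (by omega)
      rw [hVhigh v (by omega) hv2]
      rcases le_or_gt u (k + 1) with huk | huk
      · by_cases hua : u = a
        · rw [hua, hVa]
          exact hmono _ _ (by omega) (by omega)
        · have := hVlow u huk hua
          omega
      · rw [hVhigh u (by omega) hu2]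
        exact hmono _ _ (by omega) (by omega)
  · have hsa : (π.symm (V a) : ℕ) = 0 := by simp [hVa]
    have hshigh : ∀ v, k + 2 ≤ v → v ≤ 2 * k → (π.symm (V v) : ℕ) = v - k - 1 := by
      intro v hv hv'
      rw [hVhigh v hv hv', π.symm_apply_apply]
    simp only [gonPattern, Fin.lt_def]
    rw [List.pairwise_append, List.pairwise_filter, List.pairwise_cons, List.pairwise_append]
    refine ⟨⟨?_, ?_, by simp, ?_⟩, ?_, ?_⟩
    · intro v hv
      simp [List.mem_range'_1] at hv
      rw [hsa, hshigh v (by omega) (by omega)]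
      omega
    · refine (List.pairwise_lt_range' (s := k + 2) (n := k - 2)).imp_of_mem ?_
      intro u v hu hv huv
      rw [List.mem_range'_1] at hu hv
      rw [hshigh u (by omega) (by omega), hshigh v (by omega) (by omega)]
      omega
    · intro u hu v hv
      simp [List.mem_range'_1] at hu hv
      rw [hshigh u (by omega) (by omega), hshigh v (by omega) (by omega)]
      omega
    · refine (List.pairwise_lt_range' (s := 1) (n := 2 * k)).imp_of_mem ?_
      intro u v hu hv huv hu' hv'
      simp [List.mem_range'_1] at hu hv hu' hv'
      exact hlowmono u v (by omega) huv (by omega) (by omega) (by omega)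
    · intro u hu v hv
      simp [List.mem_range'_1] at hu hv
      have hv' := hlowpos v (by omega) (by omega) (by omega)
      rcases hu with rfl | hu
      · omega
      · have := hshigh u (by omega) (by omega)
        omega

/-- The permutation of `{0,…,N}` with first entry `q` whose remaining entries are order-isomorphic
to `σ`. -/
def consPerm {N : ℕ} (q : Fin (N + 1)) (σ : Equiv.Perm (Fin N)) : Equiv.Perm (Fin (N + 1)) :=
  (finSuccEquiv' 0).trans ((Equiv.optionCongr σ).trans (finSuccEquiv' q).symm)

@[simp]
theorem consPerm_zero {N : ℕ} (q : Fin (N + 1)) (σ : Equiv.Perm (Fin N)) :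
    consPerm q σ 0 = q := by
  simp [consPerm]

@[simp]
theorem consPerm_succ {N : ℕ} (q : Fin (N + 1)) (σ : Equiv.Perm (Fin N)) (i : Fin N) :
    consPerm q σ i.succ = q.succAbove (σ i) := by
  have : i.succ = (0 : Fin (N + 1)).succAbove i := by simp
  rw [this]
  simp only [consPerm, Equiv.trans_apply, finSuccEquiv'_succAbove]
  simp

theorem consPerm_injective {N : ℕ} (q : Fin (N + 1)) : Function.Injective (consPerm q) := by
  intro σ τ h
  ext i : 1
  have := DFunLike.congr_fun h i.succ
  simpa using this

theorem exists_consPerm_eq {N : ℕ} (π : Equiv.Perm (Fin (N + 1))) :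
    ∃ σ, consPerm (π 0) σ = π := by
  have h : ∀ i : Fin N, ∃ j, (π 0).succAbove j = π i.succ := fun i =>
    Fin.exists_succAbove_eq (by simp)
  choose g hg using h
  have hinj : Function.Injective g := by
    intro i j hij
    have := congrArg (π 0).succAbove hij
    rw [hg, hg] at this
    simpa using this
  refine ⟨Equiv.ofBijective g (Finite.injective_iff_bijective.1 hinj), ?_⟩
  ext i : 1
  cases i using Fin.cases with
  | zero => simp
  | succ i => simp [hg]

theorem ContainsPattern.consPerm {N : ℕ} (q : Fin (N + 1)) {σ : Equiv.Perm (Fin N)} {w : List ℕ}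
    (h : ContainsPattern σ w) : ContainsPattern (consPerm q σ) w := by
  obtain ⟨f, hf, hfw⟩ := h
  refine ⟨fun a => (f a).succ, fun a b hab => Fin.succ_lt_succ_iff.2 (hf hab), fun a b => ?_⟩
  rw [hfw, consPerm_succ, consPerm_succ, (Fin.strictMono_succAbove q).lt_iff_lt]

/-- When the first entry of `σ` is `q`, an occurrence of a pattern `u v …` in `consPerm q σ` either
comes from `σ` or uses the first two entries. -/
theorem containsPattern_of_consPerm {M : ℕ} {q : Fin (M + 2)} {σ : Equiv.Perm (Fin (M + 1))}
    (hq : (σ 0 : ℕ) = q) {u v : ℕ} {t : List ℕ}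
    (h : ContainsPattern (consPerm q σ) (u :: v :: t)) :
    ContainsPattern σ (u :: v :: t) ∨ ∃ f : Fin (u :: v :: t).length → Fin (M + 2),
      (∀ a b : Fin (u :: v :: t).length, (u :: v :: t).get a < (u :: v :: t).get b ↔
        consPerm q σ (f a) < consPerm q σ (f b)) ∧ f 0 = 0 ∧ f 1 = 1 := by
  obtain ⟨f, hf, hfw⟩ := h
  by_cases h01 : f 0 = 0 ∧ f 1 = 1
  · exact Or.inr ⟨f, hfw, h01⟩
  left
  have key : ∀ i j : Fin (M + 2), i < j → ¬ (i = 0 ∧ j = 1) →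
      Fin.predAbove 0 i < Fin.predAbove 0 j ∧
      (σ (Fin.predAbove 0 i) < σ (Fin.predAbove 0 j) ↔ consPerm q σ i < consPerm q σ j) ∧
      (σ (Fin.predAbove 0 j) < σ (Fin.predAbove 0 i) ↔ consPerm q σ j < consPerm q σ i) := by
    intro i j hij hne
    cases j using Fin.cases with
    | zero => exact absurd hij (Fin.not_lt_zero _)
    | succ j =>
      cases i using Fin.cases with
      | succ i =>
        simp only [Fin.predAbove_zero_succ, consPerm_succ,
          (Fin.strictMono_succAbove q).lt_iff_lt, and_self, and_true]
        exact Fin.succ_lt_succ_iff.1 hij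
      | zero =>
        have hj : j ≠ 0 := by
          rintro rfl
          exact hne ⟨rfl, rfl⟩
        have hσ : (σ j : ℕ) ≠ σ 0 := fun h => hj (σ.injective (Fin.ext h))
        have h00 : Fin.predAbove (0 : Fin (M + 1)) 0 = 0 := rfl
        simp only [Fin.predAbove_zero_succ, h00, consPerm_succ, consPerm_zero]
        refine ⟨Fin.pos_of_ne_zero hj, ?_⟩
        simp only [Fin.lt_def, Fin.succAbove, Fin.val_castSucc]
        split_ifs <;> simp <;> omega
  have hpair : ∀ a b, a < b → ¬ (f a = 0 ∧ f b = 1) := by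
    rintro a b hab ⟨ha, hb⟩
    have hle : ∀ c d, c ≤ d → f c ≤ f d := fun c d h => hf.monotone h
    have h0 : f 0 = 0 := by
      have := hle 0 a (Fin.zero_le _)
      rw [ha] at this
      exact Fin.le_zero_iff.1 this
    refine h01 ⟨h0, ?_⟩
    have h1b : (1 : Fin (u :: v :: t).length) ≤ b := by
      rw [Fin.le_def]
      have : (a : ℕ) < b := hab
      simp
      omega
    have h2 := hle _ _ h1b
    have h3 : f 0 < f 1 := hf (by simp)
    rw [hb] at h2
    rw [h0] at h3
    rw [Fin.le_def] at h2
    rw [Fin.lt_def] at h3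
    apply Fin.ext
    simp at h2 h3 ⊢
    omega
  refine ⟨fun a => Fin.predAbove 0 (f a), fun a b hab => (key _ _ (hf hab) (hpair a b hab)).1, ?_⟩
  intro a b
  rw [hfw]
  rcases lt_trichotomy a b with hab | rfl | hab
  · exact (key _ _ (hf hab) (hpair a b hab)).2.1.symm
  · simp
  · exact (key _ _ (hf hab) (hpair b a hab)).2.2.symm

theorem exists_gonPattern_eq {k : ℕ} (hk : 3 ≤ k) (a : ℕ) (sep : Bool) :
    ∃ t, gonPattern k a sep = a :: (k + 2) :: t := by
  obtain ⟨m, rfl⟩ := Nat.exists_eq_add_of_le' hk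
  simp only [gonPattern]
  have : m + 3 - 2 = m + 1 := by omega
  rw [this, List.range'_succ]
  simp only [List.cons_append]
  exact ⟨_, rfl⟩

theorem mem_gonPattern {k a v : ℕ} (sep : Bool) (h1 : 1 ≤ v) (h2 : v ≤ 2 * k) :
    v ∈ gonPattern k a sep := by
  simp only [gonPattern, List.mem_append, List.mem_filter, List.mem_range'_1, List.contains_iff_mem,
    Bool.not_eq_true', Bool.eq_false_iff, ne_eq]
  by_cases h : v ∈ a :: (List.range' (k + 2) (k - 2) ++ if sep = true then [1, 2 * k] else [2 * k])
  · exact Or.inl h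
  · exact Or.inr ⟨by omega, h⟩

theorem containsPattern_gonPattern_of_consPerm {k a M : ℕ} (hk : 3 ≤ k) (ha : a = k ∨ a = k + 1)
    (sep : Bool) {q : Fin (M + 2)} {σ : Equiv.Perm (Fin (M + 1))} (hq : (σ 0 : ℕ) = q)
    (hqk : (q : ℕ) + 1 = k) (h : ContainsPattern (consPerm q σ) (gonPattern k a sep)) :
    ContainsPattern σ (gonPattern k a sep) := by
  have hmem : ∀ v, 1 ≤ v → v ≤ 2 * k → v ∈ gonPattern k a sep := fun v => mem_gonPattern sep
  obtain ⟨t, ht⟩ := exists_gonPattern_eq hk a sep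
  rw [ht] at h hmem ⊢
  rcases containsPattern_of_consPerm hq h with h | ⟨f, hf, hf0, hf1⟩
  · exact h
  exfalso
  have hp1 : (consPerm q σ 1 : ℕ) = q + 1 := by
    have : (1 : Fin (M + 2)) = (0 : Fin (M + 1)).succ := rfl
    rw [this, consPerm_succ, Fin.succAbove_of_le_castSucc _ _ (by simp [Fin.le_def, hq])]
    simp [hq]
  rcases ha with rfl | rfl
  · obtain ⟨z, hz⟩ := List.get_of_mem (hmem (a + 1) (by omega) (by omega))
    have h0 := (hf 0 z).1 (by rw [hz]; simp)
    have h1 := (hf z 1).1 (by rw [hz]; simp)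
    rw [hf0, consPerm_zero, Fin.lt_def] at h0
    rw [hf1, Fin.lt_def, hp1] at h1
    omega
  · have hex : ∀ i : Fin k, ∃ z, ((k + 1) :: (k + 2) :: t).get z = i + 1 := fun i =>
      List.get_of_mem (hmem (i + 1) (by omega) (by omega))
    choose z hz using hex
    have hlt : ∀ i, (consPerm q σ (f (z i)) : ℕ) < q := by
      intro i
      have := (hf (z i) 0).1 (by rw [hz]; simp)
      rwa [hf0, consPerm_zero, Fin.lt_def] at this
    let g : Fin k → Fin q := fun i => ⟨consPerm q σ (f (z i)), hlt i⟩
    have hg : StrictMono g := by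
      intro i j hij
      have := (hf (z i) (z j)).1 (by rw [hz, hz]; simpa using hij)
      exact this
    have := Fintype.card_le_of_injective g hg.injective
    simp at this
    omega

theorem avoids321Gon_consPerm_iff {k M : ℕ} (hk : 3 ≤ k) {q : Fin (M + 2)}
    {σ : Equiv.Perm (Fin (M + 1))} (hq : (σ 0 : ℕ) = q) (hqk : (q : ℕ) + 1 = k) :
    Avoids321Gon k (consPerm q σ) ↔ Avoids321Gon k σ := by
  have h321 : AvoidsPattern (consPerm q σ) [3, 2, 1] ↔ AvoidsPattern σ [3, 2, 1] := by
    refine not_congr ⟨fun h => ?_, fun h => h.consPerm q⟩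
    rcases containsPattern_of_consPerm hq h with h | ⟨f, hf, hf0, hf1⟩
    · exact h
    · exfalso
      have h10 := (hf 1 0).1 (by simp)
      have : (1 : Fin (M + 2)) = (0 : Fin (M + 1)).succ := rfl
      rw [hf0, hf1, this, consPerm_zero, consPerm_succ,
        Fin.succAbove_of_le_castSucc _ _ (by simp [Fin.le_def, hq]), Fin.lt_def] at h10
      simp [hq] at h10
  have hgon : ∀ a, a = k ∨ a = k + 1 → ∀ sep,
      (AvoidsPattern (consPerm q σ) (gonPattern k a sep) ↔
        AvoidsPattern σ (gonPattern k a sep)) := fun a ha sep =>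
    not_congr ⟨containsPattern_gonPattern_of_consPerm hk ha sep hq hqk, fun h => h.consPerm q⟩
  simp only [Avoids321Gon, h321, hgon k (Or.inl rfl), hgon (k + 1) (Or.inr rfl)]

theorem startsWith_consPerm_iff {k N : ℕ} {q : Fin (N + 1)} (hqk : (q : ℕ) + 1 = k)
    (σ : Equiv.Perm (Fin N)) {l : List ℕ} (hl : ∀ x ∈ l, k ≤ x) :
    StartsWith (consPerm q σ) (k :: l.map (· + 1)) ↔ StartsWith σ l := by
  have hval : ∀ (i : Fin N) (x : ℕ), k ≤ x →
      ((q.succAbove (σ i) : ℕ) + 1 = x + 1 ↔ (σ i : ℕ) + 1 = x) := by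
    intro i x hx
    simp only [Fin.succAbove, Fin.lt_def, Fin.val_castSucc]
    split_ifs <;> simp only [Fin.val_castSucc, Fin.val_succ] <;> omega
  constructor
  · intro h j hj
    have := h ⟨j + 1, by simp⟩ (by simpa using hj)
    have hs : (⟨j + 1, by omega⟩ : Fin (N + 1)) = (⟨j, hj⟩ : Fin N).succ := rfl
    simp only [hs, consPerm_succ] at this
    rw [← hval _ _ (hl _ (List.get_mem _ _)), this]
    simp
  · rintro h ⟨j, hjl⟩ hj
    rcases j with _ | j
    · simpa using hqk
    · have hjl' : j < l.length := by simpa using hjl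
      have hs : (⟨j + 1, hj⟩ : Fin (N + 1)) = (⟨j, by simpa using hj⟩ : Fin N).succ := rfl
      have := h ⟨j, hjl'⟩ (by simpa using hj)
      rw [← hval _ _ (hl _ (List.get_mem _ _))] at this
      simp only [hs, consPerm_succ]
      rw [this]
      simp

theorem fstart_cons_map_succ {k M : ℕ} (hk : 3 ≤ k) (hkM : k ≤ M + 1) {l : List ℕ}
    (hl : ∀ x ∈ l, k ≤ x) :
    fstart k (M + 2) (k :: (k :: l).map (· + 1)) = fstart k (M + 1) (k :: l) := by
  set q : Fin (M + 2) := ⟨k - 1, by omega⟩ with hq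
  have hqk : (q : ℕ) + 1 = k := by
    simp only [hq]
    omega
  have hl' : ∀ x ∈ k :: l, k ≤ x := by simpa using hl
  have hfirst : ∀ σ : Equiv.Perm (Fin (M + 1)), StartsWith σ (k :: l) → (σ 0 : ℕ) = q := by
    intro σ hσ
    have := hσ ⟨0, by simp⟩ (by simp)
    simp at this
    omega
  symm
  refine Nat.card_eq_of_bijective (fun σ => ⟨consPerm q σ.1,
    (avoids321Gon_consPerm_iff hk (hfirst _ σ.2.2) hqk).2 σ.2.1,
    (startsWith_consPerm_iff hqk σ.1 hl').2 σ.2.2⟩) ⟨?_, ?_⟩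
  · intro σ τ h
    exact Subtype.ext (consPerm_injective q (congrArg Subtype.val h))
  · rintro ⟨π, hav, hst⟩
    have hπ0 : π 0 = q := by
      have := hst ⟨0, by simp⟩ (by simp)
      simp at this
      apply Fin.ext
      omega
    obtain ⟨σ, hσ⟩ := exists_consPerm_eq π
    rw [hπ0] at hσ
    subst hσ
    have hst' := (startsWith_consPerm_iff hqk σ hl').1 hst
    exact ⟨⟨σ, (avoids321Gon_consPerm_iff hk (hfirst _ hst') hqk).1 hav, hst'⟩, rfl⟩

theorem mem_of_startsWith_sort {k n : ℕ} (hk : 3 ≤ k) {s : Finset ℕ}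
    (hs : s ∈ (Finset.Icc k n).powersetCard k) {π : Equiv.Perm (Fin n)} (hav : Avoids321Gon k π)
    (hst : StartsWith π (s.sort (· ≤ ·))) : k ∈ s ∧ k + 1 ∈ s := by
  rw [Finset.mem_powersetCard] at hs
  obtain ⟨hsub, hcard⟩ := hs
  have hkn : k + 1 < n := by
    have := Finset.card_le_card hsub
    simp at this
    omega
  have hlen : (s.sort (· ≤ ·)).length = k := by rw [Finset.length_sort, hcard]
  have hval : ∀ j (hj : j < k),
      (π ⟨j, by omega⟩ : ℕ) + 1 = (s.sort (· ≤ ·))[j]'(by omega) := fun j hj =>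
    hst ⟨j, by omega⟩ (by simp; omega)
  have hins : ∀ j (hj : j < k), (π ⟨j, by omega⟩ : ℕ) + 1 ∈ s := by
    intro j hj
    rw [hval j hj, ← Finset.mem_sort (· ≤ ·)]
    exact List.getElem_mem _
  have hge : ∀ x ∈ s, k ≤ x := fun x hx => (Finset.mem_Icc.1 (hsub hx)).1
  have hmono : ∀ i j (_ : i < j) (hj : j < k), π ⟨i, by omega⟩ < π ⟨j, by omega⟩ := by
    intro i j hij hj
    have := List.pairwise_iff_getElem.1 (Finset.sortedLT_sort s).pairwise i j
      (by omega) (by omega) hij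
    rw [Fin.lt_def]
    have hi' := hval i (by omega)
    have hj' := hval j hj
    omega
  have h01 := hmono 0 1 one_pos (by omega)
  rw [Fin.lt_def] at h01
  have h0 := hins 0 (by omega)
  have h1 := hins 1 (by omega)
  have hge0 := hge _ h0
  have hπ0 : (π ⟨0, by omega⟩ : ℕ) + 1 = k := by
    by_contra hne
    exact hav.2.2.2.2 (containsPattern_gonPattern hk hkn π hav.1 hmono
      (Or.inr ⟨rfl, by omega⟩) (by omega))
  have hπ1 : (π ⟨1, by omega⟩ : ℕ) = k := by
    by_contra hne
    exact hav.2.2.1 (containsPattern_gonPattern hk hkn π hav.1 hmono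
      (Or.inl ⟨rfl, by omega⟩) (by omega))
  rw [hπ0] at h0
  rw [hπ1] at h1
  exact ⟨h0, h1⟩

theorem sort_insert_map_succ {k : ℕ} {t : Finset ℕ} (ht : ∀ x ∈ t, k + 1 ≤ x) :
    (insert k ((insert k t).map (addRightEmbedding 1))).sort (· ≤ ·) =
      k :: (k :: t.sort (· ≤ ·)).map (· + 1) := by
  rw [Finset.sort_insert, ← Finset.sort_insert (· ≤ ·) (a := k) (s := t)]
  · congr 1
    symm
    apply Finset.map_sort (addRightEmbedding 1)
    simp
  · intro b hb
    exact (ht b hb).trans' (by omega)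
  · intro h
    have := ht k h
    omega
  · intro b hb
    simp only [Finset.mem_map, Finset.mem_insert, addRightEmbedding_apply] at hb
    obtain ⟨x, rfl | hx, rfl⟩ := hb
    · omega
    · have := ht x hx
      omega
  · simp only [Finset.mem_map, Finset.mem_insert, addRightEmbedding_apply]
    rintro ⟨x, rfl | hx, h⟩
    · omega
    · have := ht x hx
      omega

/-- For `k ≥ 3` and `n ≥ k−1`: `A_k(n, k) = B_k(n−1, k−2)`, i.e. the number of
321-`k`-gon-avoiding permutations of `{1,…,n}` whose first `k` entries are increasing and
all at least `k` equals the number of 321-`k`-gon-avoiding permutations of `{1,…,n−1}`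
whose first entry is `k` and whose next `k−2` entries are increasing and all at least `k+1`. -/
theorem Aseq_eq_Bseq (k n : ℕ) (hk : 3 ≤ k) (hn : k - 1 ≤ n) :
    Aseq k k n k = Bseq k k (n-1) (k-2) := by
  obtain ⟨M, rfl⟩ : ∃ M, n = M + 2 := ⟨n - 2, by omega⟩
  simp only [Aseq, Bseq, show M + 2 - 1 = M + 1 from rfl]
  have hge : ∀ t ∈ (Finset.Icc (k + 1) (M + 1)).powersetCard (k - 2), ∀ x ∈ t, k + 1 ≤ x :=
    fun t ht x hx => (Finset.mem_Icc.1 ((Finset.mem_powersetCard.1 ht).1 hx)).1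
  have hle : ∀ t ∈ (Finset.Icc (k + 1) (M + 1)).powersetCard (k - 2), ∀ x ∈ t, x ≤ M + 1 :=
    fun t ht x hx => (Finset.mem_Icc.1 ((Finset.mem_powersetCard.1 ht).1 hx)).2
  have hkM : ∀ t ∈ (Finset.Icc (k + 1) (M + 1)).powersetCard (k - 2), k ≤ M + 1 := by
    intro t ht
    have hc := Finset.card_le_card (Finset.mem_powersetCard.1 ht).1
    rw [(Finset.mem_powersetCard.1 ht).2, Nat.card_Icc] at hc
    omega
  symm
  apply Finset.sum_of_injOn fun t => insert k ((insert k t).map (addRightEmbedding 1))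
  · intro t ht t' ht' h
    have hmem : ∀ r ∈ (Finset.Icc (k + 1) (M + 1)).powersetCard (k - 2), ∀ x,
        x ∈ r ↔ k + 1 ≤ x ∧ x + 1 ∈ insert k ((insert k r).map (addRightEmbedding 1)) := by
      intro r hr x
      have := hge r hr x
      simp
      constructor
      · intro hx
        exact ⟨this hx, Or.inr (Or.inr hx)⟩
      · rintro ⟨h1, h2 | h2 | h2⟩
        · omega
        · omega
        · exact h2
    ext x
    rw [hmem t ht, hmem t' ht']
    simp only at h
    rw [h]
  · intro t ht
    have h1 := hge t ht
    have h2 := hle t ht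
    have h3 := hkM t ht
    have h4 := (Finset.mem_powersetCard.1 ht).2
    simp only [Finset.mem_coe, Finset.mem_powersetCard]
    constructor
    · intro x hx
      simp only [Finset.mem_map, Finset.mem_insert, addRightEmbedding_apply] at hx
      rw [Finset.mem_Icc]
      obtain rfl | ⟨y, rfl | hy, rfl⟩ := hx
      · omega
      · omega
      · have := h1 y hy
        have := h2 y hy
        omega
    · rw [Finset.card_insert_of_notMem, Finset.card_map, Finset.card_insert_of_notMem]
      · omega
      · intro h
        have := h1 k h
        omega
      · simp only [Finset.mem_map, Finset.mem_insert, addRightEmbedding_apply]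
        rintro ⟨x, rfl | hx, h⟩
        · omega
        · have := h1 x hx
          omega
  · intro s hs hns
    by_contra hne
    obtain ⟨⟨π, hav, hst⟩⟩ := (Nat.card_pos_iff.1 (Nat.pos_of_ne_zero hne)).1
    obtain ⟨h0, h1⟩ := mem_of_startsWith_sort hk hs hav hst
    rw [Finset.mem_powersetCard] at hs
    obtain ⟨hsub, hcard⟩ := hs
    have himg : insert k ((insert k (((s.erase k).erase (k + 1)).image (· - 1))).map
        (addRightEmbedding 1)) = s := by
      ext x
      simp only [Finset.mem_map, Finset.mem_insert, Finset.mem_image, Finset.mem_erase,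
        addRightEmbedding_apply]
      constructor
      · rintro (rfl | ⟨y, rfl | ⟨z, ⟨hz1, hz2, hz⟩, rfl⟩, rfl⟩)
        · exact h0
        · exact h1
        · have := (Finset.mem_Icc.1 (hsub hz)).1
          rwa [Nat.sub_add_cancel (by omega)]
      · intro hx
        have := (Finset.mem_Icc.1 (hsub hx)).1
        by_cases hx0 : x = k
        · exact Or.inl hx0
        by_cases hx1 : x = k + 1
        · exact Or.inr ⟨k, Or.inl rfl, hx1.symm⟩
        · exact Or.inr ⟨x - 1, Or.inr ⟨x, ⟨hx1, hx0, hx⟩, rfl⟩, by omega⟩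
    refine hns ⟨_, ?_, himg⟩
    simp only [Finset.mem_coe, Finset.mem_powersetCard]
    constructor
    · intro x hx
      simp only [Finset.mem_image, Finset.mem_erase] at hx
      obtain ⟨z, ⟨hz1, hz2, hz⟩, rfl⟩ := hx
      have := Finset.mem_Icc.1 (hsub hz)
      rw [Finset.mem_Icc]
      omega
    · rw [Finset.card_image_of_injOn, Finset.card_erase_of_mem, Finset.card_erase_of_mem h0, hcard]
      · omega
      · simp [h1]
      · intro x hx y hy hxy
        simp only [Finset.coe_erase, Set.mem_sdiff, Finset.mem_coe] at hx hy
        have := (Finset.mem_Icc.1 (hsub hx.1.1)).1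
        have := (Finset.mem_Icc.1 (hsub hy.1.1)).1
        simp only at hxy
        omega
  · intro t ht
    rw [sort_insert_map_succ (hge t ht), fstart_cons_map_succ hk (hkM t ht)]
    intro x hx
    have := hge t ht x ((Finset.mem_sort _).1 hx)
    omega
end
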